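/- Let A ∈ ℝ^{n×N}, τ, λ > 0, L ≥ 2, B_in, B_out > 0, and suppose the samples x_1, …, x_m ∈ ℝ^N are drawn i.i.d. according to a probability distribution D with ‖x_i‖₂ ≤ B_in almost surely; set y_i = A x_i and Y = (y_1|…|y_m). Then for every δ ∈ (0,1), with probability at least 1 − δ over the draw of the samples, for all h in the hypothesis class H_2^L, the true risk L(h) = E_{x∼D} ‖h(Ax) − x‖₂ satisfies L(h) ≤ L̂(h) + 8B_out·√(Nn/m)·√(log(e(1 + 8K_L‖A‖_{2→2}/(√m·B_out)))) + 8B_out·(N/√m)·√(log(e(1 + 8M_L/(√m·B_out)))) + 4(B_in + B_out)·√(2log(4/δ)/m), where L̂(h) = (1/m) Σ_{i=1}^m ‖h(y_i) − x_i‖₂, M_L = τ‖A‖_{2→2}‖Y‖_F Σ_{k=0}^{L−1} ‖I − τAᵀA‖_{2→2}^k, and K_L = τ‖Y‖_F‖I − τAᵀA‖_{2→2}^{L−1} + τ‖Y‖_F Σ_{l=2}^{L} ‖I − τAᵀA‖_{2→2}^{L−l}(1 + 2τ‖A‖²_{2→2} Σ_{k=0}^{l−2} ‖I − τAᵀA‖_{2→2}^k).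 -/

import Mathlib

open MeasureTheory Matrix
open scoped ENNReal

noncomputable def soft (mu x : ℝ) : ℝ := Real.sign x * max 0 (|x| - mu)

noncomputable def softMat {a b : ℕ} (mu : ℝ) (M : Matrix (Fin a) (Fin b) ℝ) :
    Matrix (Fin a) (Fin b) ℝ := Matrix.of fun i j => soft mu (M i j)

noncomputable def specNorm {a b : ℕ} (A : Matrix (Fin a) (Fin b) ℝ) : ℝ :=
  ‖LinearMap.toContinuousLinearMap (Matrix.toEuclideanLin A)‖

noncomputable def frobNorm {a b : ℕ} (A : Matrix (Fin a) (Fin b) ℝ) : ℝ :=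
  Real.sqrt (∑ i, ∑ j, (A i j) ^ 2)

noncomputable def l2 {N : ℕ} (x : Fin N → ℝ) : ℝ := Real.sqrt (∑ i, x i ^ 2)

noncomputable def sigma {N : ℕ} (B : ℝ) (x : Fin N → ℝ) : Fin N → ℝ :=
  if l2 x ≤ B then x else (B / l2 x) • x

noncomputable def sigmaMat {N m : ℕ} (B : ℝ) (M : Matrix (Fin N) (Fin m) ℝ) :
    Matrix (Fin N) (Fin m) ℝ := Matrix.of fun i j => sigma B (fun k => M k j) i

def IsOrthogonal {N : ℕ} (Φ : Matrix (Fin N) (Fin N) ℝ) : Prop := Φᵀ * Φ = 1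

noncomputable def ista {n N m : ℕ} (A : Matrix (Fin n) (Fin N) ℝ) (τ lam : ℝ)
    (Φ : Matrix (Fin N) (Fin N) ℝ) (Y : Matrix (Fin n) (Fin m) ℝ) :
    ℕ → Matrix (Fin N) (Fin m) ℝ
  | 0 => 0
  | l + 1 => softMat (τ * lam)
      ((1 - τ • (Φᵀ * Aᵀ * A * Φ)) * ista A τ lam Φ Y l + τ • ((A * Φ)ᵀ * Y))

noncomputable def istaVec {n N : ℕ} (A : Matrix (Fin n) (Fin N) ℝ) (τ lam : ℝ)
    (Φ : Matrix (Fin N) (Fin N) ℝ) (y : Fin n → ℝ) : ℕ → Fin N → ℝ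
  | 0 => 0
  | l + 1 => soft (τ * lam) ∘
      ((1 - τ • (Φᵀ * Aᵀ * A * Φ)) *ᵥ istaVec A τ lam Φ y l + τ • ((A * Φ)ᵀ *ᵥ y))

noncomputable def KL {n N m : ℕ} (A : Matrix (Fin n) (Fin N) ℝ) (τ : ℝ)
    (Y : Matrix (Fin n) (Fin m) ℝ) (L : ℕ) : ℝ :=
  τ * frobNorm Y * specNorm (1 - τ • (Aᵀ * A)) ^ (L - 1)
    + τ * frobNorm Y * ∑ l ∈ Finset.Icc 2 L,
        specNorm (1 - τ • (Aᵀ * A)) ^ (L - l) *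
          (1 + 2 * τ * specNorm A ^ 2 *
            ∑ k ∈ Finset.range (l - 1), specNorm (1 - τ • (Aᵀ * A)) ^ k)

noncomputable def ML {n N m : ℕ} (A : Matrix (Fin n) (Fin N) ℝ) (τ : ℝ)
    (Y : Matrix (Fin n) (Fin m) ℝ) (L : ℕ) : ℝ :=
  τ * specNorm A * frobNorm Y * ∑ k ∈ Finset.range L, specNorm (1 - τ • (Aᵀ * A)) ^ k

noncomputable def coveringNumber {α : Type*} (d : α → α → ℝ) (s : Set α) (ε : ℝ) : ℝ≥0∞ :=
  ⨅ (t : Finset α) (_ : ∀ x ∈ s, ∃ y ∈ t, d x y ≤ ε), (t.card : ℝ≥0∞)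


namespace ISTA

lemma integral_pi_cons {E : Type*} [MeasurableSpace E] (D : Measure E) [IsProbabilityMeasure D]
    (m : ℕ) (g : (Fin (m + 1) → E) → ℝ) (hg : Measurable g) (B : ℝ) (hB : ∀ X, |g X| ≤ B) :
    ∫ X, g X ∂(Measure.pi fun _ : Fin (m + 1) => D) =
      ∫ x, ∫ X, g (Fin.cons x X) ∂(Measure.pi fun _ : Fin m => D) ∂D := by
  have h := (measurePreserving_piFinSuccAbove (fun _ : Fin (m + 1) => D) 0).symm.integral_comp' g
  rw [← h, integral_prod]
  · simp [MeasurableEquiv.piFinSuccAbove]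
    rfl
  · refine Integrable.of_bound (C := B) ?_ ?_
    · exact (hg.comp (MeasurableEquiv.measurable _)).aestronglyMeasurable
    · exact Filter.Eventually.of_forall fun p => hB _

lemma measurable_cons {E : Type*} [MeasurableSpace E] (m : ℕ) :
    Measurable (fun p : E × (Fin m → E) => (Fin.cons p.1 p.2 : Fin (m + 1) → E)) := by
  rw [measurable_pi_iff]
  intro i
  refine Fin.cases ?_ (fun j => ?_) i
  · simpa using measurable_fst
  · simpa [Function.comp_def] using (measurable_pi_apply j).comp measurable_snd

lemma integrable_bdd {E : Type*} [MeasurableSpace E] (D : Measure E) [IsProbabilityMeasure D]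
    (g : E → ℝ) (hg : Measurable g) (B : ℝ) (hB : ∀ X, |g X| ≤ B) : Integrable g D :=
  Integrable.of_bound (C := B) hg.aestronglyMeasurable (Filter.Eventually.of_forall fun p => hB _)

lemma abs_integral_le_bdd {E : Type*} [MeasurableSpace E] (D : Measure E) [IsProbabilityMeasure D]
    (g : E → ℝ) (B : ℝ) (hB : ∀ X, |g X| ≤ B) : |∫ x, g x ∂D| ≤ B := by
  have := norm_integral_le_of_norm_le_const (μ := D) (f := g) (C := B)
    (Filter.Eventually.of_forall fun p => hB _)
  simpa using this

lemma hoeffding_mgf {E : Type*} [MeasurableSpace E] (D : Measure E) [IsProbabilityMeasure D]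
    (g : E → ℝ) (hg : Measurable g) (c s : ℝ) (hc : ∀ x y, |g x - g y| ≤ c) :
    ∫ x, Real.exp (s * (g x - ∫ y, g y ∂D)) ∂D ≤ Real.exp (s ^ 2 * c ^ 2 / 2) := by
  obtain ⟨x0⟩ : Nonempty E := nonempty_of_isProbabilityMeasure D
  have h := ProbabilityTheory.hasSubgaussianMGF_of_mem_Icc (μ := D) (X := g) (a := g x0 - c)
    (b := g x0 + c) hg.aemeasurable (Filter.Eventually.of_forall fun x => by
      have := abs_le.1 (hc x x0); constructor <;> linarith)
  have h2 := h.mgf_le s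
  unfold ProbabilityTheory.mgf at h2
  refine h2.trans (le_of_eq ?_)
  congr 1
  simp only [NNReal.coe_pow, NNReal.coe_div, coe_nnnorm, NNReal.coe_ofNat, div_pow, Real.norm_eq_abs,
    sq_abs]
  ring

lemma mcd_mgf {E : Type*} [MeasurableSpace E] (D : Measure E) [IsProbabilityMeasure D]
    (c s : ℝ) : ∀ (m : ℕ) (f : (Fin m → E) → ℝ), Measurable f → ∀ B : ℝ, (∀ X, |f X| ≤ B) →
    (∀ X i x, |f (Function.update X i x) - f X| ≤ c) →
    ∫ X, Real.exp (s * (f X - ∫ Z, f Z ∂(Measure.pi fun _ : Fin m => D)))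
      ∂(Measure.pi fun _ : Fin m => D) ≤ Real.exp (m * (s ^ 2 * c ^ 2 / 2)) := by
  intro m
  induction m with
  | zero =>
    intro f hf B hB hd
    have : ∀ X, f X = f default := fun X => by rw [Subsingleton.elim X default]
    simp [this]
  | succ m ih =>
    intro f hf B hB hd
    set P := (Measure.pi fun _ : Fin m => D) with hP
    set P' := (Measure.pi fun _ : Fin (m + 1) => D) with hP'
    set F : E → ℝ := fun x => ∫ X, f (Fin.cons x X) ∂P with hF
    have hmc := hf.comp (measurable_cons (E := E) m)
    have hFm : Measurable F := by
      have := (hmc.stronglyMeasurable).integral_prod_right' (ν := P)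
      exact this.measurable
    have hmx : ∀ x, Measurable fun X : Fin m → E => f (Fin.cons x X) := fun x =>
      hmc.comp measurable_prodMk_left
    have hIntg : ∀ x, Integrable (fun X => f (Fin.cons x X)) P := fun x =>
      integrable_bdd P _ (hmx x) B (fun X => hB _)
    have hFB : ∀ x, |F x| ≤ B := fun x => abs_integral_le_bdd P _ B (fun X => hB _)
    have hFd : ∀ x y, |F x - F y| ≤ c := by
      intro x y
      rw [hF]
      simp only
      rw [← integral_sub (hIntg x) (hIntg y)]
      refine abs_integral_le_bdd P _ c (fun X => ?_)
      have := hd (Fin.cons y X) 0 x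
      simpa using this
    have hIf : ∫ Z, f Z ∂P' = ∫ x, F x ∂D := integral_pi_cons D m f hf B hB
    set I := ∫ Z, f Z ∂P' with hI
    have hIB : |I| ≤ B := abs_integral_le_bdd P' _ B hB
    have hexpB : ∀ u v : ℝ, |u| ≤ B → |v| ≤ B → |Real.exp (s * (u - v))| ≤ Real.exp (|s| * (2 * B)) := by
      intro u v hu hv
      rw [Real.abs_exp]
      apply Real.exp_le_exp.2
      refine (le_abs_self _).trans ?_
      rw [abs_mul]
      gcongr
      exact (abs_sub _ _).trans (by linarith)
    have e1 : ∫ X, Real.exp (s * (f X - I)) ∂P' =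
        ∫ x, ∫ X, Real.exp (s * (f (Fin.cons x X) - I)) ∂P ∂D := by
      refine integral_pi_cons D m (fun X => Real.exp (s * (f X - I))) ?_ (Real.exp (|s| * (2 * B))) ?_
      · fun_prop
      · intro X; exact hexpB _ _ (hB _) hIB
    have key : ∀ x, ∫ X, Real.exp (s * (f (Fin.cons x X) - I)) ∂P ≤
        Real.exp (m * (s ^ 2 * c ^ 2 / 2)) * Real.exp (s * (F x - I)) := by
      intro x
      have h1 := ih (fun X => f (Fin.cons x X)) (hmx x) B (fun X => hB _) (fun X i z => by
        have := hd (Fin.cons x X) i.succ z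
        rwa [← Fin.cons_update] at this)
      have h2 : ∀ X : Fin m → E, Real.exp (s * (f (Fin.cons x X) - I)) =
          Real.exp (s * (f (Fin.cons x X) - F x)) * Real.exp (s * (F x - I)) := by
        intro X
        rw [← Real.exp_add]; congr 1; ring
      simp_rw [h2]
      rw [integral_mul_const]
      gcongr
    rw [e1]
    have h3 : ∫ x, ∫ X, Real.exp (s * (f (Fin.cons x X) - I)) ∂P ∂D ≤
        ∫ x, Real.exp (m * (s ^ 2 * c ^ 2 / 2)) * Real.exp (s * (F x - I)) ∂D := by
      refine integral_mono_of_nonneg ?_ ?_ ?_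
      · exact Filter.Eventually.of_forall fun x => integral_nonneg fun X => (Real.exp_pos _).le
      · apply Integrable.const_mul
        refine integrable_bdd D _ (by fun_prop) (Real.exp (|s| * (2 * B))) ?_
        intro x; exact hexpB _ _ (hFB _) hIB
      · exact Filter.Eventually.of_forall key
    refine h3.trans ?_
    rw [integral_const_mul]
    have h4 := hoeffding_mgf D F hFm c s hFd
    rw [← hIf] at h4
    calc _ ≤ Real.exp (m * (s ^ 2 * c ^ 2 / 2)) * Real.exp (s ^ 2 * c ^ 2 / 2) := by gcongr
      _ = _ := by rw [← Real.exp_add]; congr 1; push_cast; ring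

/-- McDiarmid-type bound. -/
lemma mcd_tail {E : Type*} [MeasurableSpace E] (D : Measure E) [IsProbabilityMeasure D]
    (c : ℝ) (hc : 0 < c) (m : ℕ) (hm : 0 < m) (f : (Fin m → E) → ℝ) (hf : Measurable f)
    (B : ℝ) (hB : ∀ X, |f X| ≤ B)
    (hd : ∀ X i x, |f (Function.update X i x) - f X| ≤ c / m)
    (hmean : ∫ Z, f Z ∂(Measure.pi fun _ : Fin m => D) ≤ 0)
    (δ : ℝ) (hδ : 0 < δ) (hδ1 : δ < 1) :
    (Measure.pi fun _ : Fin m => D) {X | c * Real.sqrt (2 * Real.log (1 / δ) / m) ≤ f X}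
      ≤ ENNReal.ofReal δ := by
  set P := (Measure.pi fun _ : Fin m => D) with hP
  set H := Real.log (1 / δ) with hH
  have hm' : (0 : ℝ) < m := by exact_mod_cast hm
  have hHpos : 0 < H := Real.log_pos (by rw [lt_div_iff₀ hδ]; linarith)
  set t := c * Real.sqrt (2 * H / m) with ht
  have htpos : 0 < t := by positivity
  set s : ℝ := m * t / c ^ 2 with hs
  have hspos : 0 < s := by positivity
  have h1 := mcd_mgf D (c / m) s m f hf B hB hd
  set I := ∫ Z, f Z ∂P with hI
  have hIB : |I| ≤ B := abs_integral_le_bdd P _ B hB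
  have hIntg : Integrable (fun X => Real.exp (s * (f X - I))) P := by
    refine integrable_bdd P _ (by fun_prop) (Real.exp (|s| * (2 * B))) ?_
    intro u
    rw [Real.abs_exp]
    apply Real.exp_le_exp.2
    refine (le_abs_self _).trans ?_
    rw [abs_mul]
    gcongr
    exact (abs_sub _ _).trans (by linarith [hB u])
  have hsub : {X | t ≤ f X} ⊆ {X | Real.exp (s * t) ≤ Real.exp (s * (f X - I))} := by
    intro X hX
    simp only [Set.mem_ofPred_eq] at *
    apply Real.exp_le_exp.2
    apply mul_le_mul_of_nonneg_left _ hspos.le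
    linarith
  have h2 := mul_meas_ge_le_integral_of_nonneg (μ := P) (f := fun X => Real.exp (s * (f X - I)))
    (Filter.Eventually.of_forall fun X => (Real.exp_pos _).le) hIntg (Real.exp (s * t))
  have h3 : P.real {X | t ≤ f X} ≤ δ := by
    have h4 : P.real {X | t ≤ f X} ≤ P.real {X | Real.exp (s * t) ≤ Real.exp (s * (f X - I))} :=
      measureReal_mono hsub
    have h5 : Real.exp (s * t) * P.real {X | t ≤ f X} ≤ Real.exp (m * (s ^ 2 * (c / m) ^ 2 / 2)) :=
      (mul_le_mul_of_nonneg_left h4 (Real.exp_pos _).le).trans (h2.trans h1)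
    have h6 : t ^ 2 = c ^ 2 * (2 * H / m) := by
      rw [ht, mul_pow, Real.sq_sqrt (by positivity)]
    have h7 : Real.exp (m * (s ^ 2 * (c / m) ^ 2 / 2)) = Real.exp (s * t) * δ := by
      have : δ = Real.exp (-H) := by
        rw [hH, Real.log_div one_ne_zero hδ.ne', Real.log_one]; simp [Real.exp_log hδ]
      rw [this, ← Real.exp_add]
      congr 1
      have e1 : s * t = 2 * H := by
        rw [hs]
        have : m * t / c ^ 2 * t = m * t ^ 2 / c ^ 2 := by ring
        rw [this, h6]; field_simp
      have e2 : m * (s ^ 2 * (c / m) ^ 2 / 2) = s * t / 2 := by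
        rw [hs]; field_simp
      rw [e2, e1]; ring
    rw [h7] at h5
    exact le_of_mul_le_mul_left h5 (Real.exp_pos _)
  rw [← ENNReal.ofReal_toReal (measure_ne_top P _)]
  exact ENNReal.ofReal_le_ofReal h3

end ISTA

namespace ISTA

/-- sign attached to a boolean -/
noncomputable def sgn (b : Bool) : ℝ := if b then 1 else -1

lemma abs_sgn (b : Bool) : |sgn b| = 1 := by cases b <;> simp [sgn]

lemma sgn_not (b : Bool) : sgn (!b) = -sgn b := by cases b <;> simp [sgn]

/-- unnormalized empirical Rademacher average -/
noncomputable def rad {T : Type*} {m : ℕ} (S : Finset T) (hS : S.Nonempty) (v : T → Fin m → ℝ) : ℝ :=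
  (∑ ε : Fin m → Bool, S.sup' hS (fun t => ∑ i, sgn (ε i) * v t i)) / 2 ^ m

lemma sup'_abs_sub {T : Type*} (S : Finset T) (hS : S.Nonempty) (u v : T → ℝ) (c : ℝ)
    (h : ∀ t ∈ S, |u t - v t| ≤ c) : |S.sup' hS u - S.sup' hS v| ≤ c := by
  rw [abs_le]
  constructor
  · have : S.sup' hS v ≤ S.sup' hS u + c := Finset.sup'_le _ _ fun t ht => by
      have h1 := abs_le.1 (h t ht)
      have h2 := Finset.le_sup' u ht
      linarith
    linarith
  · have : S.sup' hS u ≤ S.sup' hS v + c := Finset.sup'_le _ _ fun t ht => by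
      have h1 := abs_le.1 (h t ht)
      have h2 := Finset.le_sup' v ht
      linarith
    linarith

lemma sup'_abs_le {T : Type*} (S : Finset T) (hS : S.Nonempty) (u : T → ℝ) (c : ℝ)
    (h : ∀ t ∈ S, |u t| ≤ c) : |S.sup' hS u| ≤ c := by
  have := sup'_abs_sub S hS u (fun _ => 0) c (by simpa using h)
  simpa using this

lemma rad_avg_abs_le {m : ℕ} (φ : (Fin m → Bool) → ℝ) (c : ℝ) (h : ∀ ε, |φ ε| ≤ c) :
    |(∑ ε, φ ε) / 2 ^ m| ≤ c := by
  rw [abs_div, abs_of_pos (by positivity : (0 : ℝ) < 2 ^ m), div_le_iff₀ (by positivity)]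
  calc _ ≤ ∑ ε, |φ ε| := Finset.abs_sum_le_sum_abs _ _
    _ ≤ ∑ ε : Fin m → Bool, c := Finset.sum_le_sum fun ε _ => h ε
    _ = _ := by simp; ring

lemma rad_abs_sub {T : Type*} {m : ℕ} (S : Finset T) (hS : S.Nonempty) (v w : T → Fin m → ℝ)
    (c : ℝ) (h : ∀ ε : Fin m → Bool, ∀ t ∈ S,
      |∑ i, sgn (ε i) * v t i - ∑ i, sgn (ε i) * w t i| ≤ c) :
    |rad S hS v - rad S hS w| ≤ c := by
  unfold rad
  rw [← sub_div, ← Finset.sum_sub_distrib]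
  exact rad_avg_abs_le _ _ fun ε => sup'_abs_sub _ _ _ _ _ (h ε)

lemma update_diff {E : Type*} {m : ℕ} (a : Fin m → ℝ) (ha : ∀ i, |a i| ≤ 1) (φ : E → ℝ) (c : ℝ)
    (h0 : ∀ x, 0 ≤ φ x) (h1 : ∀ x, φ x ≤ c) (X : Fin m → E) (i : Fin m) (x : E) :
    |∑ j, a j * φ (Function.update X i x j) - ∑ j, a j * φ (X j)| ≤ c := by
  rw [← Finset.sum_sub_distrib, Finset.sum_eq_single i]
  · rw [Function.update_self, ← mul_sub, abs_mul]
    have : |φ x - φ (X i)| ≤ c := by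
      rw [abs_le]; constructor <;> linarith [h0 x, h1 x, h0 (X i), h1 (X i)]
    calc _ ≤ 1 * c := by gcongr; exact ha i
      _ = c := one_mul c
  · intro j _ hj
    rw [Function.update_of_ne hj]; ring
  · simp

lemma wsum_abs_le {E : Type*} {m : ℕ} (a : Fin m → ℝ) (ha : ∀ i, |a i| ≤ 1) (φ : E → ℝ) (c : ℝ)
    (h0 : ∀ x, 0 ≤ φ x) (h1 : ∀ x, φ x ≤ c) (X : Fin m → E) :
    |∑ j, a j * φ (X j)| ≤ m * c := by
  calc _ ≤ ∑ j, |a j * φ (X j)| := Finset.abs_sum_le_sum_abs _ _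
    _ ≤ ∑ j : Fin m, c := Finset.sum_le_sum fun j _ => by
      rw [abs_mul, abs_of_nonneg (h0 _)]
      calc _ ≤ 1 * c := by gcongr; exacts [h0 _, ha j, h1 _]
        _ = c := one_mul c
    _ = _ := by simp

section symm
lemma measurable_supsum {E T : Type*} [MeasurableSpace E] (S : Finset T) (hS : S.Nonempty)
    (l : T → E → ℝ) (_hl : ∀ t, Measurable (l t)) {F : Type*} [MeasurableSpace F] (u : T → F → ℝ) (hu : ∀ t, Measurable (u t)) :
    Measurable (fun z => S.sup' hS (fun t => u t z)) := by
  have := Finset.measurable_sup' hS (f := fun t z => u t z) (fun t _ => hu t)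
  convert this using 1
  ext z
  simp [Finset.sup'_apply]

lemma symm_step1 {E T : Type*} [MeasurableSpace E] (D : Measure E) [IsProbabilityMeasure D]
    {m : ℕ} (S : Finset T) (hS : S.Nonempty) (l : T → E → ℝ) (hl : ∀ t, Measurable (l t))
    (c : ℝ) (h0 : ∀ t x, 0 ≤ l t x) (h1 : ∀ t x, l t x ≤ c) :
    ∫ X, S.sup' hS (fun t => ∑ i, ((∫ x, l t x ∂D) - l t (X i))) ∂(Measure.pi fun _ : Fin m => D) ≤
    ∫ Z, S.sup' hS (fun t => ∑ i, (l t (Z i).2 - l t (Z i).1))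
      ∂(Measure.pi fun _ : Fin m => D.prod D) := by
  set P := (Measure.pi fun _ : Fin m => D) with hP
  have hp := measurePreserving_arrowProdEquivProdArrow E E (Fin m) (fun _ => D) (fun _ => D)
  have e := hp.symm.integral_comp' (fun Z => S.sup' hS (fun t => ∑ i, (l t (Z i).2 - l t (Z i).1)))
  rw [← e]
  have hcpos : ∀ t x y, |l t x - l t y| ≤ c := fun t x y => by
    rw [abs_le]; constructor <;> linarith [h0 t x, h1 t x, h0 t y, h1 t y]
  have hsb : ∀ (X X' : Fin m → E) t, |∑ i, (l t (X' i) - l t (X i))| ≤ m * c := fun X X' t => by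
    calc _ ≤ ∑ i, |l t (X' i) - l t (X i)| := Finset.abs_sum_le_sum_abs _ _
      _ ≤ ∑ i : Fin m, c := Finset.sum_le_sum fun i _ => hcpos _ _ _
      _ = _ := by simp
  have hmeas : Measurable fun p : (Fin m → E) × (Fin m → E) =>
      S.sup' hS (fun t => ∑ i, (l t (p.2 i) - l t (p.1 i))) := by
    apply measurable_supsum S hS l hl
    intro t
    have := hl t
    fun_prop
  change _ ≤ ∫ p : (Fin m → E) × (Fin m → E),
      S.sup' hS (fun t => ∑ i, (l t (p.2 i) - l t (p.1 i))) ∂(P.prod P)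
  have hI : Integrable (fun p : (Fin m → E) × (Fin m → E) =>
      S.sup' hS (fun t => ∑ i, (l t (p.2 i) - l t (p.1 i)))) (P.prod P) :=
    integrable_bdd _ _ hmeas (m * c) fun p => sup'_abs_le _ _ _ _ fun t _ => hsb _ _ _
  rw [integral_prod _ hI]
  have hLb : ∀ t, 0 ≤ ∫ x, l t x ∂D ∧ ∫ x, l t x ∂D ≤ c := fun t => by
    refine ⟨integral_nonneg (h0 t), ?_⟩
    have := integral_mono (μ := D) (f := l t) (g := fun _ => c)
      (integrable_bdd _ _ (hl t) c fun x => by rw [abs_of_nonneg (h0 _ _)]; exact h1 _ _)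
      (integrable_const _) (h1 t)
    simpa using this
  refine integral_mono ?_ ?_ ?_
  · refine integrable_bdd _ _ ?_ (m * c) fun X => sup'_abs_le _ _ _ _ fun t _ => ?_
    · apply measurable_supsum S hS l hl
      intro t
      have := hl t
      fun_prop
    · calc _ ≤ ∑ i, |(∫ x, l t x ∂D) - l t (X i)| := Finset.abs_sum_le_sum_abs _ _
        _ ≤ ∑ i : Fin m, c := Finset.sum_le_sum fun i _ => by
          rw [abs_le]; constructor <;> linarith [h0 t (X i), h1 t (X i), hLb t]
        _ = _ := by simp
  · exact hI.integral_prod_left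
  · intro X
    refine Finset.sup'_le _ _ fun t ht => ?_
    have hli : ∀ i, Integrable (fun X' : Fin m → E => l t (X' i)) P := fun i =>
      integrable_bdd _ _ ((hl t).comp (measurable_pi_apply i)) c fun x => by
        rw [abs_of_nonneg (h0 _ _)]; exact h1 _ _
    have e2 : ∑ i, ((∫ x, l t x ∂D) - l t (X i)) = ∫ X', ∑ i, (l t (X' i) - l t (X i)) ∂P := by
      rw [integral_finsetSum]
      · refine Finset.sum_congr rfl fun i _ => ?_
        rw [integral_sub (hli i) (integrable_const _)]
        congr 1
        · have hmp := measurePreserving_eval (fun _ : Fin m => D) i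
          rw [← hmp.map_eq, integral_map hmp.measurable.aemeasurable
            (hl t).aestronglyMeasurable]
        · simp
      · intro i _
        exact (hli i).sub (integrable_const _)
    rw [e2]
    have hmt : Measurable fun X' : Fin m → E => ∑ i, (l t (X' i) - l t (X i)) := by
      have := hl t
      fun_prop
    refine integral_mono (integrable_bdd _ _ hmt (m * c) fun X' => hsb _ _ _) ?_ ?_
    · exact integrable_bdd _ _ (hmeas.comp measurable_prodMk_left) (m * c) fun p =>
        sup'_abs_le _ _ _ _ fun t _ => hsb _ _ _
    · intro X'
      exact Finset.le_sup' (fun t => ∑ i, (l t (X' i) - l t (X i))) ht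

lemma symm_step2 {E T : Type*} [MeasurableSpace E] (D : Measure E) [IsProbabilityMeasure D]
    {m : ℕ} (S : Finset T) (hS : S.Nonempty) (l : T → E → ℝ) (hl : ∀ t, Measurable (l t))
    (c : ℝ) (h0 : ∀ t x, 0 ≤ l t x) (h1 : ∀ t x, l t x ≤ c) (ε : Fin m → Bool) :
    ∫ Z, S.sup' hS (fun t => ∑ i, (l t (Z i).2 - l t (Z i).1))
      ∂(Measure.pi fun _ : Fin m => D.prod D) ≤
    ∫ X, S.sup' hS (fun t => ∑ i, sgn (ε i) * l t (X i)) ∂(Measure.pi fun _ : Fin m => D) +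
    ∫ X, S.sup' hS (fun t => ∑ i, sgn (!ε i) * l t (X i)) ∂(Measure.pi fun _ : Fin m => D) := by
  set P := (Measure.pi fun _ : Fin m => D) with hP
  set Q := (Measure.pi fun _ : Fin m => D.prod D) with hQ
  have hV : ∀ ε : Fin m → Bool, Measurable fun X : Fin m → E =>
      S.sup' hS (fun t => ∑ i, sgn (ε i) * l t (X i)) := fun ε => by
    apply measurable_supsum S hS l hl
    intro t
    have := hl t
    fun_prop
  have hVb : ∀ (ε : Fin m → Bool) (X : Fin m → E),
      |S.sup' hS (fun t => ∑ i, sgn (ε i) * l t (X i))| ≤ m * c := fun ε X =>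
    sup'_abs_le _ _ _ _ fun t _ => wsum_abs_le _ (fun i => (abs_sgn _).le) _ _ (h0 t) (h1 t) _
  let θ : (i : Fin m) → E × E → E × E := fun i z => if ε i then z else z.swap
  have hθ : ∀ i, MeasurePreserving (θ i) (D.prod D) (D.prod D) := by
    intro i
    by_cases h : ε i
    · have : θ i = id := by ext z <;> simp [θ, h]
      rw [this]; exact MeasurePreserving.id _
    · have : θ i = Prod.swap := by ext z <;> simp [θ, h]
      rw [this]; exact Measure.measurePreserving_swap
  have hpi := measurePreserving_pi (fun _ : Fin m => D.prod D) (fun _ : Fin m => D.prod D) hθ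
  have hW : Measurable fun Z : Fin m → E × E =>
      S.sup' hS (fun t => ∑ i, (l t (Z i).2 - l t (Z i).1)) := by
    apply measurable_supsum S hS l hl
    intro t
    have := hl t
    fun_prop
  have e1 : ∫ Z, S.sup' hS (fun t => ∑ i, (l t (Z i).2 - l t (Z i).1)) ∂Q =
      ∫ Z, S.sup' hS (fun t => ∑ i, sgn (ε i) * (l t (Z i).2 - l t (Z i).1)) ∂Q := by
    conv_lhs => rw [hQ, ← hpi.map_eq]
    rw [integral_map hpi.measurable.aemeasurable hW.aestronglyMeasurable]
    congr 1
    ext Z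
    congr 1
    ext t
    refine Finset.sum_congr rfl fun i _ => ?_
    by_cases h : ε i <;> simp [θ, h, sgn]
  have hfst := measurePreserving_pi (fun _ : Fin m => D.prod D) (fun _ : Fin m => D)
    (f := fun _ => Prod.fst) (fun _ => measurePreserving_fst)
  have hsnd := measurePreserving_pi (fun _ : Fin m => D.prod D) (fun _ : Fin m => D)
    (f := fun _ => Prod.snd) (fun _ => measurePreserving_snd)
  have e2 : ∫ X, S.sup' hS (fun t => ∑ i, sgn (ε i) * l t (X i)) ∂P =
      ∫ Z, S.sup' hS (fun t => ∑ i, sgn (ε i) * l t (Z i).2) ∂Q := by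
    conv_lhs => rw [hP, ← hsnd.map_eq]
    rw [integral_map hsnd.measurable.aemeasurable (hV ε).aestronglyMeasurable]
  have e3 : ∫ X, S.sup' hS (fun t => ∑ i, sgn (!ε i) * l t (X i)) ∂P =
      ∫ Z, S.sup' hS (fun t => ∑ i, sgn (!ε i) * l t (Z i).1) ∂Q := by
    conv_lhs => rw [hP, ← hfst.map_eq]
    rw [integral_map hfst.measurable.aemeasurable (hV fun i => !ε i).aestronglyMeasurable]
  have i2 : Integrable (fun Z : Fin m → E × E =>
      S.sup' hS (fun t => ∑ i, sgn (ε i) * l t (Z i).2)) Q :=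
    integrable_bdd _ _ ((hV ε).comp hsnd.measurable) (m * c) fun Z => hVb ε fun i => (Z i).2
  have i3 : Integrable (fun Z : Fin m → E × E =>
      S.sup' hS (fun t => ∑ i, sgn (!ε i) * l t (Z i).1)) Q :=
    integrable_bdd _ _ ((hV fun i => !ε i).comp hfst.measurable) (m * c)
      fun Z => hVb (fun i => !ε i) fun i => (Z i).1
  rw [e1, e2, e3, ← integral_add i2 i3]
  have key : ∀ (Z : Fin m → E × E) t, ∑ i, sgn (ε i) * (l t (Z i).2 - l t (Z i).1) =
      ∑ i, sgn (ε i) * l t (Z i).2 + ∑ i, sgn (!ε i) * l t (Z i).1 := by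
    intro Z t
    rw [← Finset.sum_add_distrib]
    refine Finset.sum_congr rfl fun i _ => ?_
    rw [sgn_not]; ring
  refine integral_mono ?_ (i2.add i3) ?_
  · refine integrable_bdd _ _ ?_ (m * c + m * c) fun Z => sup'_abs_le _ _ _ _ fun t _ => ?_
    · apply measurable_supsum S hS l hl
      intro t
      have := hl t
      fun_prop
    · rw [key]
      refine (abs_add_le _ _).trans (add_le_add ?_ ?_)
      · exact wsum_abs_le _ (fun i => (abs_sgn _).le) _ _ (h0 t) (h1 t) fun i => (Z i).2
      · exact wsum_abs_le _ (fun i => (abs_sgn _).le) _ _ (h0 t) (h1 t) fun i => (Z i).1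
  · intro Z
    refine Finset.sup'_le _ _ fun t ht => ?_
    rw [key]
    exact add_le_add (Finset.le_sup' (fun t => ∑ i, sgn (ε i) * l t (Z i).2) ht)
      (Finset.le_sup' (fun t => ∑ i, sgn (!ε i) * l t (Z i).1) ht)

lemma symm_final {E T : Type*} [MeasurableSpace E] (D : Measure E) [IsProbabilityMeasure D]
    {m : ℕ} (S : Finset T) (hS : S.Nonempty) (l : T → E → ℝ) (hl : ∀ t, Measurable (l t))
    (c : ℝ) (h0 : ∀ t x, 0 ≤ l t x) (h1 : ∀ t x, l t x ≤ c) :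
    ∫ X, S.sup' hS (fun t => ∑ i, ((∫ x, l t x ∂D) - l t (X i))) ∂(Measure.pi fun _ : Fin m => D) ≤
    2 * ∫ X, rad S hS (fun t i => l t (X i)) ∂(Measure.pi fun _ : Fin m => D) := by
  refine (symm_step1 D S hS l hl c h0 h1).trans ?_
  set P := (Measure.pi fun _ : Fin m => D) with hP
  set w := ∫ Z, S.sup' hS (fun t => ∑ i, (l t (Z i).2 - l t (Z i).1))
      ∂(Measure.pi fun _ : Fin m => D.prod D) with hw
  set V : (Fin m → Bool) → ℝ := fun ε =>
    ∫ X, S.sup' hS (fun t => ∑ i, sgn (ε i) * l t (X i)) ∂P with hVd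
  have hs : ∀ ε, w ≤ V ε + V (fun i => !ε i) := fun ε => symm_step2 D S hS l hl c h0 h1 ε
  have hrad : ∫ X, rad S hS (fun t i => l t (X i)) ∂P = (∑ ε, V ε) / 2 ^ m := by
    unfold rad
    rw [integral_div, integral_finsetSum]
    intro ε _
    refine integrable_bdd _ _ ?_ (m * c) fun X => sup'_abs_le _ _ _ _ fun t _ =>
      wsum_abs_le _ (fun i => (abs_sgn _).le) _ _ (h0 t) (h1 t) _
    apply measurable_supsum S hS l hl
    intro t
    have := hl t
    fun_prop
  have hinv : Function.Involutive (fun (ε : Fin m → Bool) i => !ε i) := fun ε => by ext i; simp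
  have hsum : ∑ ε : Fin m → Bool, V (fun i => !ε i) = ∑ ε, V ε := Equiv.sum_comp hinv.toPerm V
  have : ∑ ε : Fin m → Bool, w ≤ ∑ ε : Fin m → Bool, (V ε + V (fun i => !ε i)) :=
    Finset.sum_le_sum fun ε _ => hs ε
  rw [Finset.sum_add_distrib, hsum] at this
  simp at this
  rw [hrad, ← mul_div_assoc, le_div_iff₀ (by positivity)]
  linarith

lemma stat_bound {E T : Type*} [MeasurableSpace E] (D : Measure E) [IsProbabilityMeasure D]
    {m : ℕ} (S : Finset T) (hS : S.Nonempty) (l : T → E → ℝ) (hl : ∀ t, Measurable (l t))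
    (c : ℝ) (h0 : ∀ t x, 0 ≤ l t x) (h1 : ∀ t x, l t x ≤ c) (hc : 0 < c) (hm : 0 < m) (δ : ℝ) (hδ : 0 < δ) (hδ1 : δ < 1) :
    (Measure.pi fun _ : Fin m => D) {X | ∃ t ∈ S,
      (1 / (m : ℝ)) * ∑ i, l t (X i) + (2 / m) * rad S hS (fun t i => l t (X i))
        + 3 * c * Real.sqrt (2 * Real.log (1 / δ) / m) ≤ ∫ x, l t x ∂D}
      ≤ ENNReal.ofReal δ := by
  have hm' : (0 : ℝ) < m := by exact_mod_cast hm
  have hLb : ∀ t, 0 ≤ ∫ x, l t x ∂D ∧ ∫ x, l t x ∂D ≤ c := fun t => by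
    refine ⟨integral_nonneg (h0 t), ?_⟩
    have := integral_mono (μ := D) (f := l t) (g := fun _ => c)
      (integrable_bdd _ _ (hl t) c fun x => by rw [abs_of_nonneg (h0 _ _)]; exact h1 _ _)
      (integrable_const _) (h1 t)
    simpa using this
  let u : (Fin m → E) → ℝ := fun X => S.sup' hS (fun t => ∑ i, ((∫ x, l t x ∂D) - l t (X i)))
  let r : (Fin m → E) → ℝ := fun X => rad S hS (fun t i => l t (X i))
  have hum : Measurable u := by
    apply measurable_supsum S hS l hl
    intro t
    have := hl t
    fun_prop
  have hrm : Measurable r := by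
    apply Measurable.div_const
    refine Finset.measurable_sum _ fun ε _ => ?_
    apply measurable_supsum S hS l hl
    intro t
    have := hl t
    fun_prop
  have hub : ∀ X, |u X| ≤ m * c := fun X => sup'_abs_le _ _ _ _ fun t _ => by
    calc _ ≤ ∑ i, |(∫ x, l t x ∂D) - l t (X i)| := Finset.abs_sum_le_sum_abs _ _
      _ ≤ ∑ i : Fin m, c := Finset.sum_le_sum fun i _ => by
        rw [abs_le]; constructor <;> linarith [h0 t (X i), h1 t (X i), hLb t]
      _ = _ := by simp
  have hrb : ∀ X, |r X| ≤ m * c := fun X => rad_avg_abs_le _ _ fun ε => 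
    sup'_abs_le _ _ _ _ fun t _ =>
      wsum_abs_le _ (fun i => (abs_sgn _).le) _ _ (h0 t) (h1 t) _
  have hud : ∀ X i x, |u (Function.update X i x) - u X| ≤ c := fun X i x =>
    sup'_abs_sub _ _ _ _ _ fun t _ => by
      have := update_diff (fun _ => -1) (by simp) (l t) c (h0 t) (h1 t) X i x
      simp only [Finset.sum_sub_distrib] at this ⊢
      simp only [neg_mul, one_mul, Finset.sum_neg_distrib] at this
      convert this using 2
      ring
  have hrd : ∀ X i x, |r (Function.update X i x) - r X| ≤ c := fun X i x =>
    rad_abs_sub _ _ _ _ _ fun ε t _ =>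
      update_diff _ (fun i => (abs_sgn _).le) (l t) c (h0 t) (h1 t) X i x
  let f : (Fin m → E) → ℝ := fun X => (u X - 2 * r X) / m
  have hfm : Measurable f := by fun_prop
  have hmean : ∫ Z, f Z ∂(Measure.pi fun _ : Fin m => D) ≤ 0 := by
    have h := symm_final D (m := m) S hS l hl c h0 h1
    change ∫ Z, (u Z - 2 * r Z) / m ∂_ ≤ 0
    rw [integral_div, integral_sub (integrable_bdd _ _ hum _ hub)
      ((integrable_bdd _ _ hrm _ hrb).const_mul 2), integral_const_mul]
    apply div_nonpos_of_nonpos_of_nonneg _ hm'.le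
    linarith
  have hfb : ∀ X, |f X| ≤ 3 * c := fun X => by
    have a1 := abs_le.1 (hub X)
    have a2 := abs_le.1 (hrb X)
    rw [abs_le]
    constructor
    · rw [le_div_iff₀ hm']; linarith
    · rw [div_le_iff₀ hm']; linarith
  have hfd : ∀ X i x, |f (Function.update X i x) - f X| ≤ 3 * c / m := fun X i x => by
    have a1 := abs_le.1 (hud X i x)
    have a2 := abs_le.1 (hrd X i x)
    have : f (Function.update X i x) - f X =
      ((u (Function.update X i x) - u X) - 2 * (r (Function.update X i x) - r X)) / m := by
      simp only [f]; ring
    rw [this, abs_div, abs_of_pos hm']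
    gcongr
    rw [abs_le]
    constructor <;> linarith
  refine (measure_mono ?_).trans (mcd_tail D (3 * c) (by positivity) m hm f hfm (3 * c) hfb hfd hmean
    δ hδ hδ1)
  rintro X ⟨t, ht, hX⟩
  change _ ≤ f X
  have h2 := Finset.le_sup' (fun t => ∑ i, ((∫ x, l t x ∂D) - l t (X i))) ht
  have h3 : (∫ x, l t x ∂D) - (1 / (m : ℝ)) * ∑ i, l t (X i) ≤ u X / m := by
    rw [le_div_iff₀ hm']
    refine le_trans (le_of_eq ?_) h2
    simp only [Finset.sum_sub_distrib, Finset.sum_const, Finset.card_univ, Fintype.card_fin, nsmul_eq_mul]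
    field_simp
  have h4 : f X = u X / m - (2 / m) * r X := by simp only [f]; ring
  rw [h4]
  simp only [r]
  linarith

end symm
end ISTA

namespace ISTA

lemma rad_exp {m : ℕ} (w : Fin m → ℝ) (s r : ℝ) (hr : ∑ i, w i ^ 2 ≤ r ^ 2) :
    (∑ ε : Fin m → Bool, Real.exp (s * ∑ i, sgn (ε i) * w i)) / 2 ^ m ≤
      Real.exp (s ^ 2 * r ^ 2 / 2) := by
  have h1 : ∑ ε : Fin m → Bool, Real.exp (s * ∑ i, sgn (ε i) * w i) =
      ∏ i, (2 * Real.cosh (s * w i)) := by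
    have h := Finset.prod_univ_sum (fun _ : Fin m => (Finset.univ : Finset Bool))
      (fun i b => Real.exp (s * (sgn b * w i)))
    rw [Fintype.piFinset_univ] at h
    rw [show (∏ i, (2 * Real.cosh (s * w i))) =
      ∏ i, ∑ b : Bool, Real.exp (s * (sgn b * w i)) from ?_, h]
    · refine Finset.sum_congr rfl fun ε _ => ?_
      rw [Finset.mul_sum, Real.exp_sum]
    · refine Finset.prod_congr rfl fun i _ => ?_
      rw [Real.cosh_eq]
      simp [sgn]
      ring
  rw [h1, Finset.prod_mul_distrib]
  simp only [Finset.prod_const, Finset.card_univ, Fintype.card_fin]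
  rw [mul_div_assoc, mul_comm, div_mul_cancel₀ _ (by positivity)]
  calc _ ≤ ∏ i, Real.exp ((s * w i) ^ 2 / 2) :=
        Finset.prod_le_prod (fun i _ => (Real.cosh_pos _).le) fun i _ => Real.cosh_le_exp_half_sq _
    _ = Real.exp (s ^ 2 * (∑ i, w i ^ 2) / 2) := by
        rw [← Real.exp_sum, Finset.mul_sum, Finset.sum_div]
        congr 1
        refine Finset.sum_congr rfl fun i _ => ?_
        ring
    _ ≤ _ := by gcongr

lemma massart_aux {T : Type*} {m : ℕ} (S : Finset T) (hS : S.Nonempty) (w : T → Fin m → ℝ)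
    (r H : ℝ) (hr : ∀ t ∈ S, ∑ i, w t i ^ 2 ≤ r ^ 2) (hH : (S.card : ℝ) ≤ Real.exp H)
    (s : ℝ) (hs : 0 < s) : s * rad S hS w ≤ H + s ^ 2 * r ^ 2 / 2 := by
  set a := H + s ^ 2 * r ^ 2 / 2 with ha
  have h1 : ∀ ε : Fin m → Bool, s * S.sup' hS (fun t => ∑ i, sgn (ε i) * w t i) ≤
      (a - 1) + Real.exp (-a) * ∑ t ∈ S, Real.exp (s * ∑ i, sgn (ε i) * w t i) := by
    intro ε
    obtain ⟨t, ht, he⟩ := Finset.exists_mem_eq_sup' hS (fun t => ∑ i, sgn (ε i) * w t i)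
    rw [he]
    set x := s * ∑ i, sgn (ε i) * w t i with hx
    have h2 : Real.exp x ≤ ∑ t ∈ S, Real.exp (s * ∑ i, sgn (ε i) * w t i) :=
      Finset.single_le_sum (f := fun t => Real.exp (s * ∑ i, sgn (ε i) * w t i))
        (fun t _ => (Real.exp_pos _).le) ht
    have h3 := Real.add_one_le_exp (-a + x)
    rw [Real.exp_add] at h3
    have h4 := mul_le_mul_of_nonneg_left h2 (Real.exp_pos (-a)).le
    linarith
  have h2 : s * rad S hS w ≤ (a - 1) + Real.exp (-a) *
      ∑ t ∈ S, (∑ ε : Fin m → Bool, Real.exp (s * ∑ i, sgn (ε i) * w t i)) / 2 ^ m := by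
    unfold rad
    rw [← mul_div_assoc, Finset.mul_sum, div_le_iff₀ (by positivity)]
    refine (Finset.sum_le_sum fun ε _ => h1 ε).trans (le_of_eq ?_)
    rw [Finset.sum_add_distrib, ← Finset.mul_sum, Finset.sum_comm, ← Finset.sum_div, add_mul,
      mul_assoc (Real.exp (-a)), div_mul_cancel₀ _ (by positivity)]
    simp
    ring
  have h3 : ∑ t ∈ S, (∑ ε : Fin m → Bool, Real.exp (s * ∑ i, sgn (ε i) * w t i)) / 2 ^ m ≤
      Real.exp a := by
    calc _ ≤ ∑ t ∈ S, Real.exp (s ^ 2 * r ^ 2 / 2) :=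
          Finset.sum_le_sum fun t ht => rad_exp (w t) s r (hr t ht)
      _ = S.card * Real.exp (s ^ 2 * r ^ 2 / 2) := by simp
      _ ≤ Real.exp H * Real.exp (s ^ 2 * r ^ 2 / 2) := by gcongr
      _ = _ := by rw [← Real.exp_add]
  have h4 : Real.exp (-a) * Real.exp a = 1 := by rw [← Real.exp_add]; simp
  have h5 := mul_le_mul_of_nonneg_left h3 (Real.exp_pos (-a)).le
  linarith

lemma massart {T : Type*} {m : ℕ} (S : Finset T) (hS : S.Nonempty) (w : T → Fin m → ℝ)
    (r H : ℝ) (hr0 : 0 ≤ r) (hH0 : 0 ≤ H)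
    (hr : ∀ t ∈ S, ∑ i, w t i ^ 2 ≤ r ^ 2) (hH : (S.card : ℝ) ≤ Real.exp H) :
    rad S hS w ≤ r * Real.sqrt (2 * H) := by
  refine le_of_forall_pos_le_add fun η hη => ?_
  -- enlarge r and H slightly
  have key : ∀ r' H' : ℝ, 0 < r' → 0 < H' → r ≤ r' → H ≤ H' →
      rad S hS w ≤ r' * Real.sqrt (2 * H') := by
    intro r' H' hr' hH' h1 h2
    set q := Real.sqrt (2 * H') with hq
    have hqpos : 0 < q := by positivity
    have hq2 : q ^ 2 = 2 * H' := Real.sq_sqrt (by positivity)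
    have h3 := massart_aux S hS w r' H'
      (fun t ht => (hr t ht).trans (by gcongr)) (hH.trans (Real.exp_le_exp.2 h2))
      (q / r') (by positivity)
    have h4 : H' + (q / r') ^ 2 * r' ^ 2 / 2 = q ^ 2 := by
      field_simp; linarith
    rw [h4] at h3
    have h5 : q / r' * rad S hS w ≤ q / r' * (r' * q) := by
      refine h3.trans (le_of_eq ?_); field_simp
    exact le_of_mul_le_mul_left h5 (by positivity)
  have hcont : Filter.Tendsto (fun x : ℝ => (r + x) * Real.sqrt (2 * (H + x)))
      (nhdsWithin 0 (Set.Ioi 0)) (nhds (r * Real.sqrt (2 * H))) := by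
    have : Continuous (fun x : ℝ => (r + x) * Real.sqrt (2 * (H + x))) := by fun_prop
    have := (this.tendsto 0).mono_left (nhdsWithin_le_nhds (s := Set.Ioi 0))
    simpa using this
  have : rad S hS w ≤ r * Real.sqrt (2 * H) := by
    refine ge_of_tendsto hcont ?_
    filter_upwards [self_mem_nhdsWithin] with x hx
    have hx' : (0 : ℝ) < x := hx
    exact key _ _ (by linarith) (by linarith) (by linarith) (by linarith)
  linarith

lemma rad_step {T : Type*} {m : ℕ} (F S : Finset T) (hF : F.Nonempty) (hS : S.Nonempty)
    (v : T → Fin m → ℝ) (π : T → T) (hπ : ∀ t ∈ F, π t ∈ S) :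
    rad F hF v ≤ rad S hS v + rad F hF (fun t i => v t i - v (π t) i) := by
  unfold rad
  rw [← add_div, ← Finset.sum_add_distrib]
  gcongr with ε
  refine Finset.sup'_le _ _ fun t ht => ?_
  have h1 := Finset.le_sup' (fun t => ∑ i, sgn (ε i) * v t i) (hπ t ht)
  have h2 := Finset.le_sup' (fun t => ∑ i, sgn (ε i) * (v t i - v (π t) i)) ht
  refine le_trans (le_of_eq ?_) (add_le_add h1 h2)
  rw [← Finset.sum_add_distrib]
  refine Finset.sum_congr rfl fun i _ => ?_
  ring

lemma rad_shift {T : Type*} {m : ℕ} (F : Finset T) (hF : F.Nonempty)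
    (v : T → Fin m → ℝ) (v0 : Fin m → ℝ) :
    rad F hF v ≤ rad F hF (fun t i => v t i - v0 i) := by
  have h0 : ∑ ε : Fin m → Bool, ∑ i, sgn (ε i) * v0 i = 0 := by
    have hinv : Function.Involutive (fun (ε : Fin m → Bool) i => !ε i) := fun ε => by ext i; simp
    have hsum : ∑ ε : Fin m → Bool, ∑ i, sgn (!ε i) * v0 i = ∑ ε : Fin m → Bool, ∑ i, sgn (ε i) * v0 i :=
      Equiv.sum_comp hinv.toPerm (fun ε : Fin m → Bool => ∑ i, sgn (ε i) * v0 i)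
    simp only [sgn_not, neg_mul, Finset.sum_neg_distrib] at hsum
    linarith
  unfold rad
  have : ∑ ε : Fin m → Bool, F.sup' hF (fun t => ∑ i, sgn (ε i) * v t i) ≤
      ∑ ε : Fin m → Bool, (F.sup' hF (fun t => ∑ i, sgn (ε i) * (v t i - v0 i)) +
        ∑ i, sgn (ε i) * v0 i) := by
    refine Finset.sum_le_sum fun ε _ => Finset.sup'_le _ _ fun t ht => ?_
    have h2 := Finset.le_sup' (fun t => ∑ i, sgn (ε i) * (v t i - v0 i)) ht
    refine le_trans (le_of_eq ?_) (add_le_add h2 le_rfl)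
    rw [← Finset.sum_add_distrib]
    refine Finset.sum_congr rfl fun i _ => ?_
    ring
  rw [Finset.sum_add_distrib, h0, add_zero] at this
  gcongr

lemma chain {T : Type*} {m : ℕ} (v : T → Fin m → ℝ) (v0 : Fin m → ℝ) (Δ : ℝ) (hΔ : 0 ≤ Δ)
    (hv0 : ∀ t, ∑ i, (v t i - v0 i) ^ 2 ≤ Δ ^ 2)
    (S : ℕ → Finset T) (hS : ∀ j, (S j).Nonempty) (H : ℕ → ℝ) (hH0 : ∀ j, 0 ≤ H j)
    (hH : ∀ j, ((S j).card : ℝ) ≤ Real.exp (H j))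
    (hcov : ∀ j t, ∃ s ∈ S j, ∑ i, (v t i - v s i) ^ 2 ≤ (Δ / 2 ^ (j + 1)) ^ 2)
    (C : ℝ) (hC : ∀ J, ∑ j ∈ Finset.range J, Δ / 2 ^ j * Real.sqrt (2 * H j) ≤ C)
    (F : Finset T) (hF : F.Nonempty) : rad F hF v ≤ C := by
  choose π hπS hπ using hcov
  have h1 : ∀ J, rad (S J) (hS J) v ≤
      ∑ j ∈ Finset.range (J + 1), Δ / 2 ^ j * Real.sqrt (2 * H j) := by
    intro J
    induction J with
    | zero =>
      refine (rad_shift _ _ v v0).trans ?_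
      simp only [zero_add, Finset.range_one, Finset.sum_singleton, pow_zero, div_one]
      exact massart _ _ _ Δ _ hΔ (hH0 0) (fun t _ => hv0 t) (hH 0)
    | succ J ih =>
      rw [Finset.sum_range_succ]
      refine (rad_step (S (J + 1)) (S J) (hS _) (hS _) v (π J) (fun t _ => hπS J t)).trans
        (add_le_add ih ?_)
      exact massart _ _ _ (Δ / 2 ^ (J + 1)) _ (by positivity) (hH0 _) (fun t _ => hπ J t) (hH _)
  have hc1 : (1 : ℝ) ≤ F.card := by exact_mod_cast hF.card_pos
  have h2 : ∀ J : ℕ, rad F hF v ≤ C + Δ / 2 ^ (J + 1) * Real.sqrt (2 * Real.log F.card) := by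
    intro J
    refine (rad_step F (S J) hF (hS _) v (π J) (fun t _ => hπS J t)).trans
        (add_le_add ((h1 J).trans (hC _)) ?_)
    exact massart _ _ _ (Δ / 2 ^ (J + 1)) _ (by positivity) (Real.log_nonneg hc1)
      (fun t _ => hπ J t) (by rw [Real.exp_log (by linarith)])
  have hlim : Filter.Tendsto (fun J : ℕ => C + Δ / 2 ^ (J + 1) * Real.sqrt (2 * Real.log F.card))
      Filter.atTop (nhds (C + 0 * Real.sqrt (2 * Real.log F.card))) := by
    refine Filter.Tendsto.const_add _ (Filter.Tendsto.mul_const _ ?_)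
    have h3 : Filter.Tendsto (fun J : ℕ => (Δ / 2) * (1 / 2 : ℝ) ^ J) Filter.atTop
        (nhds (Δ / 2 * 0)) :=
      (tendsto_pow_atTop_nhds_zero_of_lt_one (by norm_num) (by norm_num)).const_mul _
    rw [mul_zero] at h3
    refine h3.congr fun J => ?_
    rw [pow_succ, one_div, inv_pow]
    field_simp
  rw [zero_mul, add_zero] at hlim
  exact ge_of_tendsto' hlim h2

lemma entropy_sum (u : ℝ) (hu : 0 ≤ u) (J : ℕ) :
    ∑ j ∈ Finset.range J, 1 / 2 ^ j * Real.sqrt (Real.log (1 + u * 2 ^ j)) ≤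
      2 * Real.sqrt (Real.log (Real.exp 1 * (1 + u))) := by
  set b := Real.log (Real.exp 1 * (1 + u)) with hb
  have hbe : b = 1 + Real.log (1 + u) := by
    rw [hb, Real.log_mul (Real.exp_pos 1).ne' (by positivity), Real.log_exp]
  have hl : 0 ≤ Real.log (1 + u) := Real.log_nonneg (by linarith)
  have hbpos : 0 < b := by linarith
  set q := Real.sqrt b with hq
  have hqpos : 0 < q := by positivity
  have hq2 : q ^ 2 = b := Real.sq_sqrt hbpos.le
  have h1 : ∀ j : ℕ, Real.sqrt (Real.log (1 + u * 2 ^ j)) ≤ (2 * b - 1 + j) / (2 * q) := by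
    intro j
    have h2j : (1 : ℝ) ≤ 2 ^ j := one_le_pow₀ (by norm_num)
    have h2 : Real.log (1 + u * 2 ^ j) ≤ b - 1 + j := by
      calc Real.log (1 + u * 2 ^ j) ≤ Real.log ((1 + u) * 2 ^ j) := by
            apply Real.log_le_log (by positivity); nlinarith
        _ = Real.log (1 + u) + j * Real.log 2 := by
            rw [Real.log_mul (by positivity) (by positivity), Real.log_pow]
        _ ≤ b - 1 + j := by
            have : Real.log 2 ≤ 1 := by
              have := Real.log_two_lt_d9; linarith
            have : (j : ℝ) * Real.log 2 ≤ j * 1 := by gcongr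
            linarith
    have h3 : 0 ≤ Real.log (1 + u * 2 ^ j) := Real.log_nonneg (by
      have : 0 ≤ u * 2 ^ j := by positivity
      linarith)
    rw [le_div_iff₀ (by positivity)]
    have h4 := sq_nonneg (Real.sqrt (Real.log (1 + u * 2 ^ j)) - q)
    have h5 := Real.sq_sqrt h3
    nlinarith
  have h2 : ∀ J : ℕ, ∑ j ∈ Finset.range J, 1 / (2 : ℝ) ^ j * ((2 * b - 1 + j) / (2 * q)) =
      (4 * b - 1 / 2 ^ J * (4 * b + 2 * J)) / (2 * q) := by
    intro J
    induction J with
    | zero => simp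
    | succ J ih =>
      rw [Finset.sum_range_succ, ih, pow_succ]
      push_cast
      field_simp
      ring
  calc _ ≤ ∑ j ∈ Finset.range J, 1 / (2 : ℝ) ^ j * ((2 * b - 1 + j) / (2 * q)) :=
        Finset.sum_le_sum fun j _ => by gcongr; exact h1 j
    _ = (4 * b - 1 / 2 ^ J * (4 * b + 2 * J)) / (2 * q) := h2 J
    _ ≤ (4 * b) / (2 * q) := by
        gcongr
        have : 0 ≤ 1 / (2 : ℝ) ^ J * (4 * b + 2 * J) := by positivity
        linarith
    _ = 2 * q := by rw [← hq2]; field_simp; ring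

lemma chain_final {T : Type*} {m : ℕ} (v : T → Fin m → ℝ) (v0 : Fin m → ℝ) (Δ : ℝ) (hΔ : 0 ≤ Δ)
    (hv0 : ∀ t, ∑ i, (v t i - v0 i) ^ 2 ≤ Δ ^ 2) (d₁ d₂ : ℕ) (u₁ u₂ : ℝ) (hu₁ : 0 ≤ u₁) (hu₂ : 0 ≤ u₂)
    (hnet : ∀ j : ℕ, ∃ S : Finset T, S.Nonempty ∧
      (S.card : ℝ) ≤ (1 + u₁ * 2 ^ j) ^ d₁ * (1 + u₂ * 2 ^ j) ^ d₂ ∧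
      ∀ t, ∃ s ∈ S, ∑ i, (v t i - v s i) ^ 2 ≤ (Δ / 2 ^ (j + 1)) ^ 2)
    (F : Finset T) (hF : F.Nonempty) :
    rad F hF v ≤ 4 * Δ * (Real.sqrt d₁ * Real.sqrt (Real.log (Real.exp 1 * (1 + u₁))) +
      Real.sqrt d₂ * Real.sqrt (Real.log (Real.exp 1 * (1 + u₂)))) := by
  choose S hS hcard hcov using hnet
  have hlog : ∀ u : ℝ, 0 ≤ u → ∀ j : ℕ, 0 ≤ Real.log (1 + u * 2 ^ j) := fun u hu j =>
    Real.log_nonneg (by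
      have : 0 ≤ u * 2 ^ j := by positivity
      linarith)
  refine chain v v0 Δ hΔ hv0 S hS
    (fun j => d₁ * Real.log (1 + u₁ * 2 ^ j) + d₂ * Real.log (1 + u₂ * 2 ^ j)) ?_ ?_ hcov _ ?_ F hF
  · intro j
    have := hlog u₁ hu₁ j
    have := hlog u₂ hu₂ j
    positivity
  · intro j
    refine (hcard j).trans (le_of_eq ?_)
    rw [Real.exp_add, mul_comm (d₁ : ℝ), mul_comm (d₂ : ℝ), Real.exp_mul, Real.exp_mul,
      Real.exp_log (by positivity), Real.exp_log (by positivity), Real.rpow_natCast,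
      Real.rpow_natCast]
  · intro J
    have hterm : ∀ j : ℕ, Δ / 2 ^ j * Real.sqrt (2 * (d₁ * Real.log (1 + u₁ * 2 ^ j) +
        d₂ * Real.log (1 + u₂ * 2 ^ j))) ≤
        2 * Δ * (Real.sqrt d₁ * (1 / 2 ^ j * Real.sqrt (Real.log (1 + u₁ * 2 ^ j))) +
          Real.sqrt d₂ * (1 / 2 ^ j * Real.sqrt (Real.log (1 + u₂ * 2 ^ j)))) := by
      intro j
      have a1 := hlog u₁ hu₁ j
      have a2 := hlog u₂ hu₂ j
      have hle : Real.sqrt (2 * (d₁ * Real.log (1 + u₁ * 2 ^ j) +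
        d₂ * Real.log (1 + u₂ * 2 ^ j))) ≤ 2 * (Real.sqrt d₁ * Real.sqrt (Real.log (1 + u₁ * 2 ^ j)) +
          Real.sqrt d₂ * Real.sqrt (Real.log (1 + u₂ * 2 ^ j))) := by
        apply Real.sqrt_le_iff.2
        refine ⟨by positivity, ?_⟩
        have e1 : (Real.sqrt d₁ * Real.sqrt (Real.log (1 + u₁ * 2 ^ j))) ^ 2 =
          d₁ * Real.log (1 + u₁ * 2 ^ j) := by
          rw [mul_pow, Real.sq_sqrt (by positivity), Real.sq_sqrt a1]
        have e2 : (Real.sqrt d₂ * Real.sqrt (Real.log (1 + u₂ * 2 ^ j))) ^ 2 =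
          d₂ * Real.log (1 + u₂ * 2 ^ j) := by
          rw [mul_pow, Real.sq_sqrt (by positivity), Real.sq_sqrt a2]
        rw [← e1, ← e2]
        have p1 : 0 ≤ Real.sqrt d₁ * Real.sqrt (Real.log (1 + u₁ * 2 ^ j)) := by positivity
        have p2 : 0 ≤ Real.sqrt d₂ * Real.sqrt (Real.log (1 + u₂ * 2 ^ j)) := by positivity
        nlinarith [mul_nonneg p1 p2, sq_nonneg (Real.sqrt d₁ * Real.sqrt (Real.log (1 + u₁ * 2 ^ j))),
          sq_nonneg (Real.sqrt d₂ * Real.sqrt (Real.log (1 + u₂ * 2 ^ j)))]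
      calc _ ≤ Δ / 2 ^ j * (2 * (Real.sqrt d₁ * Real.sqrt (Real.log (1 + u₁ * 2 ^ j)) +
          Real.sqrt d₂ * Real.sqrt (Real.log (1 + u₂ * 2 ^ j)))) := by gcongr
        _ = _ := by ring
    refine (Finset.sum_le_sum fun j _ => hterm j).trans ?_
    rw [← Finset.mul_sum, Finset.sum_add_distrib, ← Finset.mul_sum, ← Finset.mul_sum]
    have b1 := entropy_sum u₁ hu₁ J
    have b2 := entropy_sum u₂ hu₂ J
    calc _ ≤ 2 * Δ * (Real.sqrt d₁ * (2 * Real.sqrt (Real.log (Real.exp 1 * (1 + u₁)))) +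
      Real.sqrt d₂ * (2 * Real.sqrt (Real.log (Real.exp 1 * (1 + u₂))))) := by gcongr
      _ = _ := by ring

end ISTA

namespace ISTA

section norms
open scoped Matrix.Norms.L2Operator

lemma l2_eq {N : ℕ} (x : Fin N → ℝ) : l2 x = ‖(WithLp.toLp 2 x : EuclideanSpace ℝ (Fin N))‖ := by
  rw [EuclideanSpace.norm_eq]; simp [l2]

lemma specNorm_eq {a b : ℕ} (A : Matrix (Fin a) (Fin b) ℝ) : specNorm A = ‖A‖ := rfl

lemma specNorm_nonneg {a b : ℕ} (A : Matrix (Fin a) (Fin b) ℝ) : 0 ≤ specNorm A := norm_nonneg _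

lemma l2_nonneg {N : ℕ} (x : Fin N → ℝ) : 0 ≤ l2 x := Real.sqrt_nonneg _

lemma l2_sq {N : ℕ} (x : Fin N → ℝ) : l2 x ^ 2 = ∑ i, x i ^ 2 :=
  Real.sq_sqrt (Finset.sum_nonneg fun i _ => sq_nonneg _)

lemma l2_add_le {N : ℕ} (x y : Fin N → ℝ) : l2 (x + y) ≤ l2 x + l2 y := by
  simp only [l2_eq, WithLp.toLp_add]; exact norm_add_le _ _

lemma l2_smul {N : ℕ} (a : ℝ) (x : Fin N → ℝ) : l2 (a • x) = |a| * l2 x := by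
  simp only [l2_eq, WithLp.toLp_smul, norm_smul, Real.norm_eq_abs]

lemma l2_neg {N : ℕ} (x : Fin N → ℝ) : l2 (-x) = l2 x := by simp [l2]

lemma l2_zero {N : ℕ} : l2 (0 : Fin N → ℝ) = 0 := by simp [l2]

lemma l2_sub_le {N : ℕ} (x y : Fin N → ℝ) : l2 (x - y) ≤ l2 x + l2 y := by
  rw [sub_eq_add_neg, ← l2_neg y]; exact l2_add_le _ _

lemma abs_l2_sub_le {N : ℕ} (x y : Fin N → ℝ) : |l2 x - l2 y| ≤ l2 (x - y) := by
  simp only [l2_eq, WithLp.toLp_sub]; exact abs_norm_sub_norm_le _ _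

lemma l2_mulVec {a b : ℕ} (A : Matrix (Fin a) (Fin b) ℝ) (x : Fin b → ℝ) :
    l2 (A *ᵥ x) ≤ specNorm A * l2 x := by
  rw [l2_eq, l2_eq, specNorm_eq]
  exact Matrix.l2_opNorm_mulVec A (WithLp.toLp 2 x)

lemma specNorm_transpose {a b : ℕ} (A : Matrix (Fin a) (Fin b) ℝ) : specNorm Aᵀ = specNorm A := by
  rw [specNorm_eq, specNorm_eq, ← Matrix.l2_opNorm_conjTranspose A, conjTranspose_eq_transpose_of_trivial]

lemma specNorm_mul_le {a b c : ℕ} (A : Matrix (Fin a) (Fin b) ℝ) (B : Matrix (Fin b) (Fin c) ℝ) :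
    specNorm (A * B) ≤ specNorm A * specNorm B := Matrix.l2_opNorm_mul A B

lemma specNorm_one_le {N : ℕ} : specNorm (1 : Matrix (Fin N) (Fin N) ℝ) ≤ 1 := by
  rw [specNorm_eq, ← Matrix.diagonal_one, Matrix.l2_opNorm_diagonal]
  exact (pi_norm_le_iff_of_nonneg zero_le_one).2 fun i => by simp

lemma specNorm_orth {N : ℕ} (Φ : Matrix (Fin N) (Fin N) ℝ) (h : IsOrthogonal Φ) :
    specNorm Φ ≤ 1 := by
  have h1 := Matrix.l2_opNorm_conjTranspose_mul_self Φ
  rw [conjTranspose_eq_transpose_of_trivial, h] at h1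
  have h2 := specNorm_one_le (N := N)
  rw [specNorm_eq, h1] at h2
  rw [specNorm_eq]
  nlinarith [norm_nonneg Φ]

lemma specNorm_conj {n N : ℕ} (A : Matrix (Fin n) (Fin N) ℝ) (τ : ℝ) (Φ : Matrix (Fin N) (Fin N) ℝ)
    (h : IsOrthogonal Φ) :
    specNorm (1 - τ • (Φᵀ * Aᵀ * A * Φ)) ≤ specNorm (1 - τ • (Aᵀ * A)) := by
  have e : 1 - τ • (Φᵀ * Aᵀ * A * Φ) = Φᵀ * (1 - τ • (Aᵀ * A)) * Φ := by
    rw [Matrix.mul_sub, Matrix.sub_mul, Matrix.mul_one, h, Matrix.mul_smul, Matrix.smul_mul]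
    simp only [Matrix.mul_assoc]
  rw [e]
  have h1 := specNorm_orth Φ h
  have h2 := specNorm_transpose Φ
  have h3 := specNorm_nonneg (1 - τ • (Aᵀ * A))
  have h4 := specNorm_nonneg Φ
  calc _ ≤ specNorm (Φᵀ * (1 - τ • (Aᵀ * A))) * specNorm Φ := specNorm_mul_le _ _
    _ ≤ (specNorm Φᵀ * specNorm (1 - τ • (Aᵀ * A))) * specNorm Φ := by
        gcongr; exact specNorm_mul_le _ _
    _ ≤ (1 * specNorm (1 - τ • (Aᵀ * A))) * 1 := by rw [h2]; gcongr
    _ = _ := by ring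

lemma specNorm_mul_orth {n N : ℕ} (A : Matrix (Fin n) (Fin N) ℝ) (Φ : Matrix (Fin N) (Fin N) ℝ)
    (h : IsOrthogonal Φ) : specNorm (A * Φ) ≤ specNorm A :=
  (specNorm_mul_le _ _).trans
    (mul_le_of_le_one_right (specNorm_nonneg _) (specNorm_orth Φ h))

lemma continuous_l2 {N : ℕ} : Continuous (l2 : (Fin N → ℝ) → ℝ) := by
  unfold l2; fun_prop

lemma soft_eq (mu x : ℝ) (hmu : 0 ≤ mu) : soft mu x = max (x - mu) 0 - max (-x - mu) 0 := by
  unfold soft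
  rcases lt_trichotomy x 0 with h | h | h
  · rw [Real.sign_of_neg h, abs_of_neg h, max_eq_right (by linarith : x - mu ≤ 0), max_comm]; ring
  · subst h; simp
  · rw [Real.sign_of_pos h, abs_of_pos h, max_eq_right (by linarith : -x - mu ≤ 0), max_comm]; ring

lemma soft_lip (mu x y : ℝ) (hmu : 0 ≤ mu) : |soft mu x - soft mu y| ≤ |x - y| := by
  rw [soft_eq _ _ hmu, soft_eq _ _ hmu]
  rcases max_cases (x - mu) 0 with ⟨h1, h1'⟩ | ⟨h1, h1'⟩ <;>
  rcases max_cases (-x - mu) 0 with ⟨h2, h2'⟩ | ⟨h2, h2'⟩ <;>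
  rcases max_cases (y - mu) 0 with ⟨h3, h3'⟩ | ⟨h3, h3'⟩ <;>
  rcases max_cases (-y - mu) 0 with ⟨h4, h4'⟩ | ⟨h4, h4'⟩ <;>
  rw [h1, h2, h3, h4] <;>
  rcases abs_cases (x - y) with ⟨h5, h5'⟩ | ⟨h5, h5'⟩ <;> rw [h5, abs_le] <;> constructor <;> linarith

lemma soft_zero (mu : ℝ) : soft mu 0 = 0 := by simp [soft]

lemma continuous_soft (mu : ℝ) (hmu : 0 ≤ mu) : Continuous (soft mu) := by
  have : soft mu = fun x => max (x - mu) 0 - max (-x - mu) 0 := funext fun x => soft_eq mu x hmu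
  rw [this]; fun_prop

lemma l2_soft_sub {N : ℕ} (mu : ℝ) (hmu : 0 ≤ mu) (x y : Fin N → ℝ) :
    l2 (soft mu ∘ x - soft mu ∘ y) ≤ l2 (x - y) := by
  unfold l2
  apply Real.sqrt_le_sqrt
  refine Finset.sum_le_sum fun i _ => ?_
  simp only [Pi.sub_apply, Function.comp_apply]
  exact sq_le_sq.2 (soft_lip mu _ _ hmu)

lemma l2_soft {N : ℕ} (mu : ℝ) (hmu : 0 ≤ mu) (x : Fin N → ℝ) :
    l2 (soft mu ∘ x) ≤ l2 x := by
  have := l2_soft_sub mu hmu x 0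
  have e : soft mu ∘ (0 : Fin N → ℝ) = 0 := by ext i; simp [soft_zero]
  simpa [e] using this

lemma l2_sigma {N : ℕ} (B : ℝ) (hB : 0 < B) (x : Fin N → ℝ) : l2 (sigma B x) ≤ B := by
  unfold sigma
  split_ifs with h
  · exact h
  · push Not at h
    have : 0 < l2 x := hB.trans h
    rw [l2_smul, abs_of_pos (by positivity), div_mul_cancel₀ _ this.ne']

lemma l2_comb {N : ℕ} (a b : ℝ) (x y : Fin N → ℝ) :
    l2 (a • x - b • y) ^ 2 = a ^ 2 * l2 x ^ 2 + b ^ 2 * l2 y ^ 2 - 2 * a * b * ∑ i, x i * y i := by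
  simp only [l2_sq, Finset.mul_sum, ← Finset.sum_add_distrib, ← Finset.sum_sub_distrib]
  refine Finset.sum_congr rfl fun i _ => ?_
  simp; ring

lemma inner_le_l2 {N : ℕ} (x y : Fin N → ℝ) : ∑ i, x i * y i ≤ l2 x * l2 y := by
  have h := l2_comb (l2 y) (l2 x) x y
  have h0 := sq_nonneg (l2 (l2 y • x - l2 x • y))
  rcases (mul_nonneg (l2_nonneg x) (l2_nonneg y)).eq_or_lt with h1 | h1
  · have h2 := Finset.sum_mul_sq_le_sq_mul_sq Finset.univ x y
    rw [← l2_sq, ← l2_sq, ← mul_pow, ← h1] at h2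
    rw [← h1]
    nlinarith
  · rw [h] at h0
    have : 0 ≤ 2 * (l2 x * l2 y) * (l2 x * l2 y - ∑ i, x i * y i) := by nlinarith
    by_contra hcon
    push Not at hcon
    nlinarith

lemma sigma_lip_aux {N : ℕ} (B : ℝ) (hB : 0 < B) (x y : Fin N → ℝ) (hx : ¬ l2 x ≤ B) (hy : l2 y ≤ B) :
    l2 ((B / l2 x) • x - y) ≤ l2 (x - y) := by
  push Not at hx
  apply le_of_sq_le_sq _ (l2_nonneg _)
  have e1 := l2_comb (B / l2 x) 1 x y
  have e2 := l2_comb 1 1 x y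
  rw [one_smul] at e1 e2
  rw [one_smul] at e2
  rw [e1, e2]
  have h := inner_le_l2 x y
  set p := ∑ i, x i * y i
  set a := l2 x
  set b := l2 y
  have ha : 0 < a := hB.trans hx
  have hr : B / a < 1 := by rw [div_lt_one ha]; exact hx
  have e3 : (B / a) ^ 2 * a ^ 2 = B ^ 2 := by field_simp
  have e4 : B / a * a = B := by field_simp
  rw [e3]
  have h5 : p * (1 - B / a) ≤ a * b * (1 - B / a) := mul_le_mul_of_nonneg_right h (by linarith)
  have h6 : a * b * (1 - B / a) = b * (a - B) := by field_simp
  nlinarith [mul_nonneg (sub_nonneg.2 hx.le) (by linarith : 0 ≤ a + B - 2 * b)]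

lemma sigma_lip {N : ℕ} (B : ℝ) (hB : 0 < B) (x y : Fin N → ℝ) :
    l2 (sigma B x - sigma B y) ≤ l2 (x - y) := by
  unfold sigma
  split_ifs with hx hy hy
  · exact le_rfl
  · rw [← l2_neg (x - y), ← l2_neg (x - _), neg_sub, neg_sub]
    exact sigma_lip_aux B hB y x hy hx
  · exact sigma_lip_aux B hB x y hx hy
  · push Not at hx hy
    apply le_of_sq_le_sq _ (l2_nonneg _)
    have e2 := l2_comb 1 1 x y
    rw [one_smul, one_smul] at e2
    rw [l2_comb, e2]
    have h := inner_le_l2 x y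
    set p := ∑ i, x i * y i
    set a := l2 x
    set b := l2 y
    have ha : 0 < a := hB.trans hx
    have hb : 0 < b := hB.trans hy
    have e3 : (B / a) ^ 2 * a ^ 2 = B ^ 2 := by field_simp
    have e4 : (B / b) ^ 2 * b ^ 2 = B ^ 2 := by field_simp
    have hr : B / a * (B / b) ≤ 1 := by
      have h1 : B / a < 1 := by rw [div_lt_one ha]; exact hx
      have h2 : B / b < 1 := by rw [div_lt_one hb]; exact hy
      have h3 : 0 < B / a := by positivity
      have h4 : 0 < B / b := by positivity
      nlinarith
    rw [e3, e4]
    have h5 : p * (1 - B / a * (B / b)) ≤ a * b * (1 - B / a * (B / b)) :=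
      mul_le_mul_of_nonneg_right h (by linarith)
    have h6 : a * b * (1 - B / a * (B / b)) = a * b - B ^ 2 := by field_simp
    nlinarith [sq_nonneg (a - b)]

lemma continuous_sigma {N : ℕ} (B : ℝ) (hB : 0 < B) :
    Continuous (sigma B : (Fin N → ℝ) → (Fin N → ℝ)) := by
  rw [continuous_pi_iff]
  intro i
  rw [continuous_iff_continuousAt]
  intro x
  unfold ContinuousAt
  rw [tendsto_iff_dist_tendsto_zero]
  have h1 : Filter.Tendsto (fun y => l2 (y - x)) (nhds x) (nhds 0) := by
    have : Continuous fun y : Fin N → ℝ => l2 (y - x) := continuous_l2.comp (by fun_prop)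
    have := this.tendsto x
    simpa [l2_zero] using this
  refine squeeze_zero (fun _ => dist_nonneg) (fun y => ?_) h1
  refine le_trans ?_ (sigma_lip B hB y x)
  rw [Real.dist_eq]
  unfold l2
  apply Real.abs_le_sqrt
  exact Finset.single_le_sum (f := fun k => (sigma B y - sigma B x) k ^ 2)
    (fun k _ => sq_nonneg _) (Finset.mem_univ i)

end norms
end ISTA

namespace ISTA

/-- per-sample version of `ML` -/
noncomputable def mm {n N : ℕ} (A : Matrix (Fin n) (Fin N) ℝ) (τ : ℝ) (L : ℕ) : ℝ :=
  τ * specNorm A * ∑ k ∈ Finset.range L, specNorm (1 - τ • (Aᵀ * A)) ^ k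

/-- per-sample version of `KL` -/
noncomputable def kk {n N : ℕ} (A : Matrix (Fin n) (Fin N) ℝ) (τ : ℝ) (L : ℕ) : ℝ :=
  τ * specNorm (1 - τ • (Aᵀ * A)) ^ (L - 1)
    + τ * ∑ l ∈ Finset.Icc 2 L,
        specNorm (1 - τ • (Aᵀ * A)) ^ (L - l) *
          (1 + 2 * τ * specNorm A ^ 2 *
            ∑ k ∈ Finset.range (l - 1), specNorm (1 - τ • (Aᵀ * A)) ^ k)

lemma KL_eq {n N m : ℕ} (A : Matrix (Fin n) (Fin N) ℝ) (τ : ℝ) (Y : Matrix (Fin n) (Fin m) ℝ) (L : ℕ) :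
    KL A τ Y L = kk A τ L * frobNorm Y := by
  unfold KL kk; ring

lemma ML_eq {n N m : ℕ} (A : Matrix (Fin n) (Fin N) ℝ) (τ : ℝ) (Y : Matrix (Fin n) (Fin m) ℝ) (L : ℕ) :
    ML A τ Y L = mm A τ L * frobNorm Y := by
  unfold ML mm; ring

lemma mm_nonneg {n N : ℕ} (A : Matrix (Fin n) (Fin N) ℝ) (τ : ℝ) (hτ : 0 < τ) (L : ℕ) :
    0 ≤ mm A τ L := by
  have h1 := specNorm_nonneg A
  have h2 := specNorm_nonneg (1 - τ • (Aᵀ * A))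
  unfold mm; positivity

lemma kk_nonneg {n N : ℕ} (A : Matrix (Fin n) (Fin N) ℝ) (τ : ℝ) (hτ : 0 < τ) (L : ℕ) :
    0 ≤ kk A τ L := by
  have h1 := specNorm_nonneg A
  have h2 := specNorm_nonneg (1 - τ • (Aᵀ * A))
  unfold kk; positivity

lemma mm_succ {n N : ℕ} (A : Matrix (Fin n) (Fin N) ℝ) (τ : ℝ) (l : ℕ) :
    mm A τ (l + 1) = specNorm (1 - τ • (Aᵀ * A)) * mm A τ l + τ * specNorm A := by
  unfold mm
  rw [Finset.sum_range_succ']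
  simp only [pow_succ, pow_zero, ← Finset.sum_mul]
  ring

lemma kk_succ {n N : ℕ} (A : Matrix (Fin n) (Fin N) ℝ) (τ : ℝ) (l : ℕ) :
    kk A τ (l + 2) = specNorm (1 - τ • (Aᵀ * A)) * kk A τ (l + 1)
      + τ * (1 + 2 * specNorm A * mm A τ (l + 1)) := by
  unfold kk mm
  set q := specNorm (1 - τ • (Aᵀ * A))
  rw [Finset.sum_Icc_succ_top (by omega : 2 ≤ l + 1 + 1)]
  have h : ∀ i ∈ Finset.Icc 2 (l + 1), q ^ (l + 1 + 1 - i) *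
      (1 + 2 * τ * specNorm A ^ 2 * ∑ k ∈ Finset.range (i - 1), q ^ k) =
      q * (q ^ (l + 1 - i) * (1 + 2 * τ * specNorm A ^ 2 * ∑ k ∈ Finset.range (i - 1), q ^ k)) := by
    intro i hi
    have := (Finset.mem_Icc.1 hi).2
    rw [show l + 1 + 1 - i = (l + 1 - i) + 1 by omega, pow_succ]
    ring
  rw [Finset.sum_congr rfl h, ← Finset.mul_sum]
  simp only [show l + 2 - 1 = l + 1 by omega, show l + 1 - 1 = l by omega, show l + 1 + 1 - 1 = l + 1 by omega,
    Nat.sub_self, pow_zero, pow_succ q l]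
  ring

section

lemma ista_norm {n N : ℕ} (A : Matrix (Fin n) (Fin N) ℝ) (τ lam : ℝ) (hτ : 0 < τ) (hlam : 0 < lam)
    (y : Fin n → ℝ) (Φ : Matrix (Fin N) (Fin N) ℝ) (hΦ : IsOrthogonal Φ) (l : ℕ) :
    l2 (istaVec A τ lam Φ y l) ≤ mm A τ l * l2 y := by
  induction l with
  | zero => simp [istaVec, l2_zero, mm]
  | succ l ih =>
    rw [mm_succ]
    unfold istaVec
    have h0 := l2_nonneg y
    have hq := specNorm_nonneg (1 - τ • (Aᵀ * A))
    have h1 := specNorm_conj A τ Φ hΦ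
    have h2 := specNorm_mul_orth A Φ hΦ
    rw [← specNorm_transpose] at h2
    calc _ ≤ l2 ((1 - τ • (Φᵀ * Aᵀ * A * Φ)) *ᵥ istaVec A τ lam Φ y l + τ • ((A * Φ)ᵀ *ᵥ y)) :=
          l2_soft _ (by positivity) _
      _ ≤ l2 ((1 - τ • (Φᵀ * Aᵀ * A * Φ)) *ᵥ istaVec A τ lam Φ y l) + l2 (τ • ((A * Φ)ᵀ *ᵥ y)) :=
          l2_add_le _ _
      _ ≤ specNorm (1 - τ • (Φᵀ * Aᵀ * A * Φ)) * l2 (istaVec A τ lam Φ y l)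
          + τ * (specNorm (A * Φ)ᵀ * l2 y) := by
          rw [l2_smul, abs_of_pos hτ]
          gcongr
          · exact l2_mulVec _ _
          · exact l2_mulVec _ _
      _ ≤ specNorm (1 - τ • (Aᵀ * A)) * (mm A τ l * l2 y) + τ * (specNorm A * l2 y) := by
          have := l2_nonneg (istaVec A τ lam Φ y l)
          gcongr
      _ = _ := by ring

lemma ista_diff {n N : ℕ} (A : Matrix (Fin n) (Fin N) ℝ) (τ lam : ℝ) (hτ : 0 < τ) (hlam : 0 < lam)
    (y : Fin n → ℝ) (Φ Φ' : Matrix (Fin N) (Fin N) ℝ) (hΦ : IsOrthogonal Φ) (hΦ' : IsOrthogonal Φ') (l : ℕ) :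
    l2 (istaVec A τ lam Φ y (l + 1) - istaVec A τ lam Φ' y (l + 1)) ≤
      kk A τ (l + 1) * specNorm (A * Φ - A * Φ') * l2 y := by
  set d := specNorm (A * Φ - A * Φ') with hd
  have hd0 : 0 ≤ d := specNorm_nonneg _
  have h0 := l2_nonneg y
  have hsA := specNorm_nonneg A
  have hq := specNorm_nonneg (1 - τ • (Aᵀ * A))
  have hlin : l2 (τ • ((A * Φ)ᵀ *ᵥ y) - τ • ((A * Φ')ᵀ *ᵥ y)) ≤ τ * (d * l2 y) := by
    rw [← smul_sub, ← Matrix.sub_mulVec, ← Matrix.transpose_sub, l2_smul, abs_of_pos hτ]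
    gcongr
    rw [hd, ← specNorm_transpose]
    exact l2_mulVec _ _
  induction l with
  | zero =>
    have : kk A τ (0 + 1) = τ := by simp [kk]
    rw [this]
    simp only [istaVec, Matrix.mulVec_zero, zero_add]
    refine (l2_soft_sub _ (by positivity) _ _).trans (hlin.trans (le_of_eq (by ring)))
  | succ l ih =>
    rw [kk_succ]
    rw [istaVec.eq_2, istaVec.eq_2 A τ lam Φ']
    set f := istaVec A τ lam Φ y (l + 1)
    set f' := istaVec A τ lam Φ' y (l + 1)
    have hf' : l2 f' ≤ mm A τ (l + 1) * l2 y := ista_norm A τ lam hτ hlam y Φ' hΦ' (l + 1)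
    have h1 := specNorm_conj A τ Φ hΦ
    have h2 := specNorm_mul_orth A Φ hΦ
    have h3 := specNorm_mul_orth A Φ' hΦ'
    rw [← specNorm_transpose] at h2
    have hmat : (1 - τ • (Φᵀ * Aᵀ * A * Φ)) - (1 - τ • (Φ'ᵀ * Aᵀ * A * Φ')) =
        -(τ • ((A * Φ)ᵀ * (A * Φ - A * Φ') + (A * Φ - A * Φ')ᵀ * (A * Φ'))) := by
      have : (A * Φ)ᵀ * (A * Φ - A * Φ') + (A * Φ - A * Φ')ᵀ * (A * Φ') =
          Φᵀ * Aᵀ * A * Φ - Φ'ᵀ * Aᵀ * A * Φ' := by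
        simp only [Matrix.transpose_sub, Matrix.transpose_mul, Matrix.mul_sub, Matrix.sub_mul,
          Matrix.mul_assoc]
        abel
      rw [this, smul_sub]; abel
    have hvec : ((1 - τ • (Φᵀ * Aᵀ * A * Φ)) *ᵥ f + τ • ((A * Φ)ᵀ *ᵥ y)) -
        ((1 - τ • (Φ'ᵀ * Aᵀ * A * Φ')) *ᵥ f' + τ • ((A * Φ')ᵀ *ᵥ y)) =
        (1 - τ • (Φᵀ * Aᵀ * A * Φ)) *ᵥ (f - f') +
        ((-τ) • ((A * Φ)ᵀ *ᵥ ((A * Φ - A * Φ') *ᵥ f') + (A * Φ - A * Φ')ᵀ *ᵥ ((A * Φ') *ᵥ f')) +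
        (τ • ((A * Φ)ᵀ *ᵥ y) - τ • ((A * Φ')ᵀ *ᵥ y))) := by
      have h4 : (-τ) • ((A * Φ)ᵀ *ᵥ ((A * Φ - A * Φ') *ᵥ f') + (A * Φ - A * Φ')ᵀ *ᵥ ((A * Φ') *ᵥ f'))
          = ((1 - τ • (Φᵀ * Aᵀ * A * Φ)) - (1 - τ • (Φ'ᵀ * Aᵀ * A * Φ'))) *ᵥ f' := by
        rw [hmat, Matrix.mulVec_mulVec, Matrix.mulVec_mulVec, ← Matrix.add_mulVec,
          Matrix.neg_mulVec, Matrix.smul_mulVec, neg_smul]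
      rw [h4]
      generalize (1 - τ • (Φᵀ * Aᵀ * A * Φ)) = P
      generalize (1 - τ • (Φ'ᵀ * Aᵀ * A * Φ')) = Q
      rw [Matrix.mulVec_sub, Matrix.sub_mulVec]
      abel
    refine (l2_soft_sub _ (by positivity) _ _).trans ?_
    rw [hvec]
    refine (l2_add_le _ _).trans ?_
    have a1 : l2 ((1 - τ • (Φᵀ * Aᵀ * A * Φ)) *ᵥ (f - f')) ≤
        specNorm (1 - τ • (Aᵀ * A)) * (kk A τ (l + 1) * d * l2 y) := by
      refine (l2_mulVec _ _).trans ?_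
      have := l2_nonneg (f - f')
      gcongr
    have a2 : l2 ((A * Φ)ᵀ *ᵥ ((A * Φ - A * Φ') *ᵥ f')) ≤ specNorm A * (d * (mm A τ (l + 1) * l2 y)) := by
      refine (l2_mulVec _ _).trans ?_
      have b1 : l2 ((A * Φ - A * Φ') *ᵥ f') ≤ d * (mm A τ (l + 1) * l2 y) :=
        (l2_mulVec _ _).trans (by gcongr)
      have := l2_nonneg ((A * Φ - A * Φ') *ᵥ f')
      gcongr
    have a3 : l2 ((A * Φ - A * Φ')ᵀ *ᵥ ((A * Φ') *ᵥ f')) ≤ d * (specNorm A * (mm A τ (l + 1) * l2 y)) := by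
      refine (l2_mulVec _ _).trans ?_
      rw [specNorm_transpose]
      have b1 : l2 ((A * Φ') *ᵥ f') ≤ specNorm A * (mm A τ (l + 1) * l2 y) := by
        refine (l2_mulVec _ _).trans ?_
        have := l2_nonneg f'
        gcongr
      gcongr
    have a4 : l2 ((-τ) • ((A * Φ)ᵀ *ᵥ ((A * Φ - A * Φ') *ᵥ f') +
        (A * Φ - A * Φ')ᵀ *ᵥ ((A * Φ') *ᵥ f'))) ≤ τ * (specNorm A * (d * (mm A τ (l + 1) * l2 y)) +
          d * (specNorm A * (mm A τ (l + 1) * l2 y))) := by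
      rw [l2_smul, abs_neg, abs_of_pos hτ]
      gcongr
      exact (l2_add_le _ _).trans (add_le_add a2 a3)
    refine (add_le_add a1 ((l2_add_le _ _).trans (add_le_add a4 hlin))).trans (le_of_eq ?_)
    ring

lemma hyp_diff {n N : ℕ} (A : Matrix (Fin n) (Fin N) ℝ) (τ lam : ℝ) (hτ : 0 < τ) (hlam : 0 < lam)
    (y : Fin n → ℝ) (B : ℝ) (hB : 0 < B) (Ψ Ψ' Φ Φ' : Matrix (Fin N) (Fin N) ℝ) (hΨ : IsOrthogonal Ψ)
    (hΦ : IsOrthogonal Φ) (hΦ' : IsOrthogonal Φ') (l : ℕ) (hl : 2 ≤ l) :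
    l2 (sigma B (Ψ *ᵥ istaVec A τ lam Φ y l) - sigma B (Ψ' *ᵥ istaVec A τ lam Φ' y l)) ≤
      (kk A τ l * specNorm (A * Φ - A * Φ') + mm A τ l * specNorm (Ψ - Ψ')) * l2 y := by
  obtain ⟨k, rfl⟩ : ∃ k, l = k + 1 := ⟨l - 1, by omega⟩
  refine (sigma_lip B hB _ _).trans ?_
  set f := istaVec A τ lam Φ y (k + 1)
  set f' := istaVec A τ lam Φ' y (k + 1)
  have e : Ψ *ᵥ f - Ψ' *ᵥ f' = Ψ *ᵥ (f - f') + (Ψ - Ψ') *ᵥ f' := by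
    rw [Matrix.mulVec_sub, Matrix.sub_mulVec]; abel
  have h1 : l2 (f - f') ≤ kk A τ (k + 1) * specNorm (A * Φ - A * Φ') * l2 y :=
    ista_diff A τ lam hτ hlam y Φ Φ' hΦ hΦ' k
  have h2 : l2 f' ≤ mm A τ (k + 1) * l2 y := ista_norm A τ lam hτ hlam y Φ' hΦ' (k + 1)
  rw [e]
  refine (l2_add_le _ _).trans ?_
  have a1 : l2 (Ψ *ᵥ (f - f')) ≤ 1 * (kk A τ (k + 1) * specNorm (A * Φ - A * Φ') * l2 y) := by
    refine (l2_mulVec _ _).trans ?_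
    have := l2_nonneg (f - f')
    gcongr
    exact specNorm_orth Ψ hΨ
  have a2 : l2 ((Ψ - Ψ') *ᵥ f') ≤ specNorm (Ψ - Ψ') * (mm A τ (k + 1) * l2 y) := by
    refine (l2_mulVec _ _).trans ?_
    have := specNorm_nonneg (Ψ - Ψ')
    gcongr
  refine (add_le_add a1 a2).trans (le_of_eq (by ring))

lemma continuous_hyp {n N : ℕ} (A : Matrix (Fin n) (Fin N) ℝ) (τ lam : ℝ) (hτ : 0 < τ) (hlam : 0 < lam)
    (B : ℝ) (hB : 0 < B) (l : ℕ) :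
    Continuous fun p : (Matrix (Fin N) (Fin N) ℝ × Matrix (Fin N) (Fin N) ℝ) × (Fin n → ℝ) =>
      sigma B (p.1.1 *ᵥ istaVec A τ lam p.1.2 p.2 l) := by
  refine (continuous_sigma B hB).comp ?_
  have : Continuous fun p : (Matrix (Fin N) (Fin N) ℝ × Matrix (Fin N) (Fin N) ℝ) × (Fin n → ℝ) =>
      istaVec A τ lam p.1.2 p.2 l := by
    induction l with
    | zero => simp only [istaVec]; exact continuous_const
    | succ l ih =>
      simp only [istaVec]
      have hs := continuous_soft (τ * lam) (by positivity)
      have hv : Continuous fun p : (Matrix (Fin N) (Fin N) ℝ × Matrix (Fin N) (Fin N) ℝ) × (Fin n → ℝ) =>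
          ((1 - τ • (p.1.2ᵀ * Aᵀ * A * p.1.2)) *ᵥ istaVec A τ lam p.1.2 p.2 l + τ • ((A * p.1.2)ᵀ *ᵥ p.2)) := ?_
      · exact continuous_pi fun i => hs.comp ((continuous_pi_iff.1 hv) i)
      refine Continuous.add ?_ ?_
      · refine Continuous.matrix_mulVec ?_ ih
        fun_prop
      · have h1 : Continuous fun p : (Matrix (Fin N) (Fin N) ℝ × Matrix (Fin N) (Fin N) ℝ) × (Fin n → ℝ) =>
            (A * p.1.2)ᵀ := by fun_prop
        have h2 := Continuous.matrix_mulVec h1 continuous_snd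
        exact h2.const_smul τ
  exact Continuous.matrix_mulVec (by fun_prop) this

end

section nets

lemma packing_card {V : Type*} [NormedAddCommGroup V] [NormedSpace ℝ V] [FiniteDimensional ℝ V]
    {T : Type*} (φ : T → V) (R : ℝ) (hR : 0 ≤ R) (hφ : ∀ t, ‖φ t‖ ≤ R) (η : ℝ) (hη : 0 < η)
    (S : Finset T) (hS : ∀ s ∈ S, ∀ t ∈ S, s ≠ t → η ≤ ‖φ s - φ t‖) :
    (S.card : ℝ) ≤ (1 + 2 * R / η) ^ Module.finrank ℝ V := by
  borelize V
  let μ : Measure V := Measure.addHaar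
  have hδ : 0 < η / 2 := by positivity
  have ρpos : 0 < R + η / 2 := by positivity
  have D : Set.Pairwise (S : Set T) (Function.onFun Disjoint fun c => Metric.ball (φ c) (η / 2)) := by
    rintro c hc d hd hcd
    apply Metric.ball_disjoint_ball
    rw [dist_eq_norm]
    have := hS c hc d hd hcd
    linarith
  have A_subset : (⋃ c ∈ S, Metric.ball (φ c) (η / 2)) ⊆ Metric.ball (0 : V) (R + η / 2) := by
    refine Set.iUnion₂_subset fun x hx => ?_
    apply Metric.ball_subset_ball'
    rw [dist_zero_right]
    linarith [hφ x]
  have I : (S.card : ℝ≥0∞) * ENNReal.ofReal ((η / 2) ^ Module.finrank ℝ V) * μ (Metric.ball 0 1) ≤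
      ENNReal.ofReal ((R + η / 2) ^ Module.finrank ℝ V) * μ (Metric.ball 0 1) :=
    calc
      _ = μ (⋃ c ∈ S, Metric.ball (φ c) (η / 2)) := by
        rw [measure_biUnion_finset D fun c _ => measurableSet_ball]
        simp only [μ.addHaar_ball_of_pos _ hδ]
        simp only [Finset.sum_const, nsmul_eq_mul, mul_assoc]
      _ ≤ μ (Metric.ball (0 : V) (R + η / 2)) := measure_mono A_subset
      _ = _ := by
        simp only [μ.addHaar_ball_of_pos _ ρpos]
  have J : (S.card : ℝ≥0∞) * ENNReal.ofReal ((η / 2) ^ Module.finrank ℝ V) ≤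
      ENNReal.ofReal ((R + η / 2) ^ Module.finrank ℝ V) :=
    (ENNReal.mul_le_mul_iff_left (Metric.measure_ball_pos _ _ zero_lt_one).ne'
      measure_ball_lt_top.ne).1 I
  have K := ENNReal.toReal_le_of_le_ofReal (pow_nonneg ρpos.le _) J
  rw [ENNReal.toReal_mul, ENNReal.toReal_natCast, ENNReal.toReal_ofReal (by positivity)] at K
  rw [← le_div_iff₀ (by positivity), ← div_pow] at K
  refine K.trans (le_of_eq ?_)
  congr 1
  field_simp
  ring

lemma net_exists {V : Type*} [NormedAddCommGroup V] [NormedSpace ℝ V] [FiniteDimensional ℝ V]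
    {T : Type*} [Nonempty T] (φ : T → V) (R : ℝ) (hR : 0 ≤ R) (hφ : ∀ t, ‖φ t‖ ≤ R)
    (K : ℝ) (hK : 0 ≤ K) (ε : ℝ) (hε : 0 < ε) :
    ∃ S : Finset T, S.Nonempty ∧ (S.card : ℝ) ≤ (1 + 2 * R * K / ε) ^ Module.finrank ℝ V ∧
      ∀ t, ∃ s ∈ S, K * ‖φ t - φ s‖ ≤ ε := by
  classical
  obtain ⟨t0⟩ := (inferInstance : Nonempty T)
  rcases hK.eq_or_lt with rfl | hK
  · exact ⟨{t0}, by simp, by simp, fun t => ⟨t0, by simp, by simpa using hε.le⟩⟩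
  set η := ε / K with hη
  have hηpos : 0 < η := by positivity
  let Sep : Finset T → Prop := fun S => ∀ s ∈ S, ∀ t ∈ S, s ≠ t → η ≤ ‖φ s - φ t‖
  let P : ℕ → Prop := fun k => ∃ S : Finset T, Sep S ∧ S.card = k
  have hbd : ∀ S, Sep S → (S.card : ℝ) ≤ (1 + 2 * R / η) ^ Module.finrank ℝ V := fun S hS =>
    packing_card φ R hR hφ η hηpos S hS
  set M := ⌊(1 + 2 * R / η) ^ Module.finrank ℝ V⌋₊ with hM
  have hP0 : P 0 := ⟨∅, by simp [Sep], rfl⟩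
  obtain ⟨S, hS, hcard⟩ : P (Nat.findGreatest P M) := Nat.findGreatest_spec (Nat.zero_le M) hP0
  have hcov : ∀ t, ∃ s ∈ S, K * ‖φ t - φ s‖ ≤ ε := by
    intro t
    by_contra hcon
    push Not at hcon
    have hcon' : ∀ s ∈ S, η ≤ ‖φ t - φ s‖ := fun s hs => by
      rw [hη, div_le_iff₀ hK, mul_comm]; exact (hcon s hs).le
    have htS : t ∉ S := fun h => by
      have := hcon t h
      simp at this
      linarith
    have hsep : Sep (insert t S) := by
      intro a ha b hb hab
      rcases Finset.mem_insert.1 ha with rfl | ha' <;> rcases Finset.mem_insert.1 hb with rfl | hb'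
      · exact absurd rfl hab
      · exact hcon' b hb'
      · rw [norm_sub_rev]; exact hcon' a ha'
      · exact hS a ha' b hb' hab
    have h1 : (insert t S).card ≤ M := Nat.le_floor (hbd _ hsep)
    have h2 : (insert t S).card ≤ Nat.findGreatest P M := Nat.le_findGreatest h1 ⟨_, hsep, rfl⟩
    rw [Finset.card_insert_of_notMem htS, hcard] at h2
    omega
  refine ⟨S, ?_, ?_, hcov⟩
  · obtain ⟨s, hs, _⟩ := hcov t0
    exact ⟨s, hs⟩
  · refine (hbd S hS).trans (le_of_eq ?_)
    congr 2
    rw [hη]; field_simp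

open scoped Matrix.Norms.L2Operator in
lemma net_matrix {a b : ℕ} {T : Type*} [Nonempty T] (φ : T → Matrix (Fin a) (Fin b) ℝ)
    (R : ℝ) (hR : 0 ≤ R) (hφ : ∀ t, specNorm (φ t) ≤ R)
    (K : ℝ) (hK : 0 ≤ K) (ε : ℝ) (hε : 0 < ε) :
    ∃ S : Finset T, S.Nonempty ∧ (S.card : ℝ) ≤ (1 + 2 * R * K / ε) ^ (a * b) ∧
      ∀ t, ∃ s ∈ S, K * specNorm (φ t - φ s) ≤ ε := by
  have h := net_exists φ R hR hφ K hK ε hε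
  have : Module.finrank ℝ (Matrix (Fin a) (Fin b) ℝ) = a * b := by
    simp [Module.finrank_matrix]
  rw [this] at h
  exact h

end nets
end ISTA

namespace ISTA
section final
variable {n N : ℕ}

/-- hypothesis -/
noncomputable def hyp (A : Matrix (Fin n) (Fin N) ℝ) (τ lam : ℝ) (L : ℕ) (B : ℝ)
    (p : Matrix (Fin N) (Fin N) ℝ × Matrix (Fin N) (Fin N) ℝ) (x : Fin N → ℝ) : Fin N → ℝ :=
  sigma B (p.1 *ᵥ istaVec A τ lam p.2 (A *ᵥ x) L)

/-- parameter space -/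
abbrev Par (N : ℕ) : Type := {p : Matrix (Fin N) (Fin N) ℝ × Matrix (Fin N) (Fin N) ℝ //
  IsOrthogonal p.1 ∧ IsOrthogonal p.2}

/-- truncated loss -/
noncomputable def tl (A : Matrix (Fin n) (Fin N) ℝ) (τ lam : ℝ) (L : ℕ) (B Bin : ℝ)
    (p : Par N) (x : Fin N → ℝ) : ℝ :=
  if l2 x ≤ Bin then l2 (hyp A τ lam L B p.1 x - x) else 0

lemma continuous_hyp2 (A : Matrix (Fin n) (Fin N) ℝ) (τ lam : ℝ) (hτ : 0 < τ) (hlam : 0 < lam)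
    (L : ℕ) (B : ℝ) (hB : 0 < B) :
    Continuous fun q : (Matrix (Fin N) (Fin N) ℝ × Matrix (Fin N) (Fin N) ℝ) × (Fin N → ℝ) =>
      l2 (hyp A τ lam L B q.1 q.2 - q.2) := by
  have h0 : Continuous fun q : (Matrix (Fin N) (Fin N) ℝ × Matrix (Fin N) (Fin N) ℝ) × (Fin N → ℝ) =>
      (q.1, A *ᵥ q.2) :=
    continuous_fst.prodMk (Continuous.matrix_mulVec continuous_const continuous_snd)
  have h1 := (continuous_hyp A τ lam hτ hlam B hB L).comp h0
  exact continuous_l2.comp (h1.sub continuous_snd)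

lemma tl_measurable (A : Matrix (Fin n) (Fin N) ℝ) (τ lam : ℝ) (hτ : 0 < τ) (hlam : 0 < lam)
    (L : ℕ) (B Bin : ℝ) (hB : 0 < B) (p : Par N) : Measurable (tl A τ lam L B Bin p) := by
  unfold tl
  refine Measurable.ite ?_ ?_ measurable_const
  · exact (isClosed_le continuous_l2 continuous_const).measurableSet
  · have h : Continuous fun x : Fin N → ℝ => (p.1, x) := by fun_prop
    exact ((continuous_hyp2 A τ lam hτ hlam L B hB).comp h).measurable

lemma tl_nonneg (A : Matrix (Fin n) (Fin N) ℝ) (τ lam : ℝ) (L : ℕ) (B Bin : ℝ) (p : Par N)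
    (x : Fin N → ℝ) : 0 ≤ tl A τ lam L B Bin p x := by
  unfold tl; split_ifs
  · exact l2_nonneg _
  · exact le_rfl

lemma tl_le (A : Matrix (Fin n) (Fin N) ℝ) (τ lam : ℝ) (L : ℕ) (B Bin : ℝ) (hB : 0 < B)
    (hBin : 0 < Bin) (p : Par N)
    (x : Fin N → ℝ) : tl A τ lam L B Bin p x ≤ Bin + B := by
  unfold tl; split_ifs with h
  · have := l2_sub_le (hyp A τ lam L B p.1 x) x
    have h2 : l2 (hyp A τ lam L B p.1 x) ≤ B := l2_sigma B hB _
    linarith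
  · positivity

lemma tl_diff (A : Matrix (Fin n) (Fin N) ℝ) (τ lam : ℝ) (hτ : 0 < τ) (hlam : 0 < lam)
    (L : ℕ) (hL : 2 ≤ L) (B Bin : ℝ) (hB : 0 < B) (p q : Par N) (x : Fin N → ℝ) :
    |tl A τ lam L B Bin p x - tl A τ lam L B Bin q x| ≤
      (kk A τ L * specNorm (A * p.1.2 - A * q.1.2) + mm A τ L * specNorm (p.1.1 - q.1.1)) *
        l2 (A *ᵥ x) := by
  have h := hyp_diff A τ lam hτ hlam (A *ᵥ x) B hB p.1.1 q.1.1 p.1.2 q.1.2 p.2.1 p.2.2 q.2.2 L hL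
  unfold tl; split_ifs
  · refine (abs_l2_sub_le _ _).trans ?_
    rw [sub_sub_sub_cancel_right]
    exact h
  · rw [sub_self, abs_zero]
    exact (l2_nonneg _).trans h

/-- truncated norm -/
noncomputable def tn (Bin : ℝ) (x : Fin N → ℝ) : ℝ := if l2 x ≤ Bin then l2 x else 0

lemma tl_tn (A : Matrix (Fin n) (Fin N) ℝ) (τ lam : ℝ)
    (L : ℕ) (B Bin : ℝ) (hB : 0 < B) (p : Par N) (x : Fin N → ℝ) :
    |tl A τ lam L B Bin p x - tn Bin x| ≤ B := by
  unfold tl tn; split_ifs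
  · have := abs_l2_sub_le (hyp A τ lam L B p.1 x - x) (-x)
    rw [l2_neg] at this
    refine this.trans ?_
    rw [sub_neg_eq_add, sub_add_cancel]
    exact l2_sigma B hB _
  · simp [hB.le]

lemma sum_l2_sq {m : ℕ} (A : Matrix (Fin n) (Fin N) ℝ) (X : Fin m → Fin N → ℝ) :
    ∑ i, l2 (A *ᵥ X i) ^ 2 = frobNorm (A * Matrix.of fun k i => X i k) ^ 2 := by
  unfold frobNorm
  rw [Real.sq_sqrt (by positivity), Finset.sum_comm]
  refine Finset.sum_congr rfl fun i _ => ?_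
  rw [l2_sq]
  rfl

lemma frob_nonneg {a b : ℕ} (Y : Matrix (Fin a) (Fin b) ℝ) : 0 ≤ frobNorm Y := Real.sqrt_nonneg _

instance : Nonempty (Par N) := ⟨⟨(1, 1), by simp [IsOrthogonal], by simp [IsOrthogonal]⟩⟩

lemma rad_bound {m : ℕ} (hm : 0 < m) (A : Matrix (Fin n) (Fin N) ℝ) (τ lam : ℝ) (hτ : 0 < τ)
    (hlam : 0 < lam) (L : ℕ) (hL : 2 ≤ L) (B Bin : ℝ) (hB : 0 < B) (X : Fin m → Fin N → ℝ)
    (F : Finset (Par N)) (hF : F.Nonempty) :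
    rad F hF (fun t i => tl A τ lam L B Bin t (X i)) ≤
      4 * (Real.sqrt m * B) * (Real.sqrt ((n * N : ℕ) : ℝ) * Real.sqrt (Real.log (Real.exp 1 * (1 +
          8 * KL A τ (A * Matrix.of fun k i => X i k) L * specNorm A / (Real.sqrt (m : ℝ) * B))))
        + Real.sqrt ((N * N : ℕ) : ℝ) * Real.sqrt (Real.log (Real.exp 1 * (1 +
          8 * ML A τ (A * Matrix.of fun k i => X i k) L / (Real.sqrt (m : ℝ) * B))))) := by
  classical
  have hm' : (0 : ℝ) < m := by exact_mod_cast hm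
  set Y := (A * Matrix.of fun k i => X i k) with hY
  have hK0 : 0 ≤ KL A τ Y L := by
    rw [KL_eq]; exact mul_nonneg (kk_nonneg A τ hτ L) (frob_nonneg Y)
  have hM0 : 0 ≤ ML A τ Y L := by
    rw [ML_eq]; exact mul_nonneg (mm_nonneg A τ hτ L) (frob_nonneg Y)
  have hA0 := specNorm_nonneg A
  set Δ := Real.sqrt m * B with hΔ
  have hΔ0 : 0 < Δ := by positivity
  refine chain_final (fun (t : Par N) i => tl A τ lam L B Bin t (X i)) (fun i => tn Bin (X i)) Δ hΔ0.le
    ?_ (n * N) (N * N) _ _ (by positivity) (by positivity) ?_ F hF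
  · intro t
    calc _ ≤ ∑ i : Fin m, B ^ 2 := Finset.sum_le_sum fun i _ => by
            rw [← sq_abs]
            gcongr
            exact tl_tn A τ lam L B Bin hB t (X i)
      _ = Δ ^ 2 := by
            rw [hΔ, mul_pow, Real.sq_sqrt hm'.le]; simp
  · intro j
    set ε := Δ / 2 ^ (j + 1) with hε
    have hε0 : 0 < ε := by positivity
    let O := {Φ : Matrix (Fin N) (Fin N) ℝ // IsOrthogonal Φ}
    haveI : Nonempty O := ⟨⟨1, by simp [IsOrthogonal]⟩⟩
    obtain ⟨S₁, hS₁, hc₁, hn₁⟩ := net_matrix (fun Φ : O => A * Φ.1) (specNorm A) hA0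
      (fun Φ => (specNorm_mul_orth A Φ.1 Φ.2)) (KL A τ Y L) hK0 (ε / 2) (by positivity)
    obtain ⟨S₂, hS₂, hc₂, hn₂⟩ := net_matrix (fun Φ : O => Φ.1) 1 zero_le_one
      (fun Φ => (specNorm_orth Φ.1 Φ.2)) (ML A τ Y L) hM0 (ε / 2) (by positivity)
    let e : O × O → Par N := fun z => ⟨(z.2.1, z.1.1), z.2.2, z.1.2⟩
    refine ⟨(S₁ ×ˢ S₂).image e, (hS₁.product hS₂).image e, ?_, ?_⟩
    · have h1 : (((S₁ ×ˢ S₂).image e).card : ℝ) ≤ (S₁.card : ℝ) * S₂.card := by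
        have := Finset.card_image_le (s := S₁ ×ˢ S₂) (f := e)
        rw [Finset.card_product] at this
        exact_mod_cast this
      refine h1.trans ?_
      have e1 : 2 * specNorm A * KL A τ Y L / (ε / 2) = 8 * KL A τ Y L * specNorm A / Δ * 2 ^ j := by
        rw [hε, pow_succ]; field_simp; ring
      have e2 : 2 * 1 * ML A τ Y L / (ε / 2) = 8 * ML A τ Y L / Δ * 2 ^ j := by
        rw [hε, pow_succ]; field_simp; ring
      rw [e1] at hc₁
      rw [e2] at hc₂
      gcongr
    · intro t
      obtain ⟨s₁, hs₁, hd₁⟩ := hn₁ ⟨t.1.2, t.2.2⟩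
      obtain ⟨s₂, hs₂, hd₂⟩ := hn₂ ⟨t.1.1, t.2.1⟩
      refine ⟨e (s₁, s₂), Finset.mem_image_of_mem e (Finset.mk_mem_product hs₁ hs₂), ?_⟩
      set w := kk A τ L * specNorm (A * t.1.2 - A * s₁.1) + mm A τ L * specNorm (t.1.1 - s₂.1) with hw
      have hw0 : 0 ≤ w := by
        have := kk_nonneg A τ hτ L
        have := mm_nonneg A τ hτ L
        have := specNorm_nonneg (A * t.1.2 - A * s₁.1)
        have := specNorm_nonneg (t.1.1 - s₂.1)
        positivity
      calc _ ≤ ∑ i, (w * l2 (A *ᵥ X i)) ^ 2 := Finset.sum_le_sum fun i _ => by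
              rw [← sq_abs]
              gcongr
              exact tl_diff A τ lam hτ hlam L hL B Bin hB t (e (s₁, s₂)) (X i)
        _ = (w * frobNorm Y) ^ 2 := by
              simp only [mul_pow]
              rw [← Finset.mul_sum, sum_l2_sq]
        _ ≤ ε ^ 2 := by
              have := frob_nonneg Y
              gcongr
              rw [KL_eq] at hd₁
              rw [ML_eq] at hd₂
              simp only at hd₁ hd₂
              rw [hw]
              linarith

/-- right-hand side -/
noncomputable def rhs {m : ℕ} (A : Matrix (Fin n) (Fin N) ℝ) (τ : ℝ) (L : ℕ) (Bin Bout δ : ℝ)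
    (X : Fin m → Fin N → ℝ) : ℝ :=
  8 * Bout * Real.sqrt ((N : ℝ) * (n : ℝ) / (m : ℝ)) *
                  Real.sqrt (Real.log (Real.exp 1 * (1 +
                    8 * KL A τ (A * Matrix.of fun k i => X i k) L * specNorm A /
                      (Real.sqrt (m : ℝ) * Bout))))
              + 8 * Bout * ((N : ℝ) / Real.sqrt (m : ℝ)) *
                  Real.sqrt (Real.log (Real.exp 1 * (1 +
                    8 * ML A τ (A * Matrix.of fun k i => X i k) L /
                      (Real.sqrt (m : ℝ) * Bout))))
              + 4 * (Bin + Bout) * Real.sqrt (2 * Real.log (4 / δ) / (m : ℝ))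

lemma rhs_bound {m : ℕ} (hm : 0 < m) (A : Matrix (Fin n) (Fin N) ℝ) (τ lam : ℝ) (hτ : 0 < τ)
    (hlam : 0 < lam) (L : ℕ) (hL : 2 ≤ L) (B Bin : ℝ) (hB : 0 < B) (hBin : 0 < Bin)
    (δ : ℝ) (hδ : 0 < δ) (hδ1 : δ < 1) (X : Fin m → Fin N → ℝ)
    (F : Finset (Par N)) (hF : F.Nonempty) :
    (2 / m) * rad F hF (fun t i => tl A τ lam L B Bin t (X i))
      + 3 * (Bin + B) * Real.sqrt (2 * Real.log (1 / δ) / m) ≤ rhs A τ L Bin B δ X := by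
  have hm' : (0 : ℝ) < m := by exact_mod_cast hm
  have h := rad_bound hm A τ lam hτ hlam L hL B Bin hB X F hF
  unfold rhs
  set a := Real.sqrt (Real.log (Real.exp 1 * (1 +
          8 * KL A τ (A * Matrix.of fun k i => X i k) L * specNorm A / (Real.sqrt (m : ℝ) * B))))
  set b := Real.sqrt (Real.log (Real.exp 1 * (1 +
          8 * ML A τ (A * Matrix.of fun k i => X i k) L / (Real.sqrt (m : ℝ) * B))))
  have hs : 0 < Real.sqrt m := by positivity
  have hss : Real.sqrt m * Real.sqrt m = m := Real.mul_self_sqrt hm'.le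
  have h1 : (2 / m) * rad F hF (fun t i => tl A τ lam L B Bin t (X i)) ≤
      (2 / m) * (4 * (Real.sqrt m * B) * (Real.sqrt ((n * N : ℕ) : ℝ) * a +
        Real.sqrt ((N * N : ℕ) : ℝ) * b)) := by gcongr
  have e1 : Real.sqrt ((N * N : ℕ) : ℝ) = N := by
    push_cast; exact Real.sqrt_mul_self (by positivity)
  have e2 : Real.sqrt ((N : ℝ) * n / m) = Real.sqrt ((n * N : ℕ) : ℝ) / Real.sqrt m := by
    rw [← Real.sqrt_div (by positivity)]; push_cast; rw [mul_comm]
  have e3 : (2 / (m : ℝ)) * (4 * (Real.sqrt m * B) * (Real.sqrt ((n * N : ℕ) : ℝ) * a +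
        Real.sqrt ((N * N : ℕ) : ℝ) * b)) =
      8 * B * Real.sqrt ((N : ℝ) * n / m) * a + 8 * B * ((N : ℝ) / Real.sqrt m) * b := by
    rw [e1, e2]
    have : (2 / (m : ℝ)) = 2 / (Real.sqrt m * Real.sqrt m) := by rw [hss]
    rw [this]
    field_simp
    ring
  have h2 : Real.sqrt (2 * Real.log (1 / δ) / m) ≤ Real.sqrt (2 * Real.log (4 / δ) / m) := by
    gcongr
    norm_num
  have h3 : 3 * (Bin + B) * Real.sqrt (2 * Real.log (1 / δ) / m) ≤
      4 * (Bin + B) * Real.sqrt (2 * Real.log (4 / δ) / m) := by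
    gcongr
    norm_num
  linarith

end final

end ISTA

namespace ISTA
section final2
variable {n N : ℕ}

instance : SecondCountableTopology (Matrix (Fin N) (Fin N) ℝ) :=
  inferInstanceAs (SecondCountableTopology (Fin N → Fin N → ℝ))

/-- violation of the bound for a parameter -/
def bad {m : ℕ} (A : Matrix (Fin n) (Fin N) ℝ) (τ lam : ℝ) (L : ℕ) (Bin Bout δ : ℝ)
    (D : Measure (Fin N → ℝ)) (t : Par N) : Set (Fin m → Fin N → ℝ) :=
  {X | (1 / (m : ℝ)) * ∑ i, tl A τ lam L Bout Bin t (X i) + rhs A τ L Bin Bout δ X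
    ≤ ∫ x, tl A τ lam L Bout Bin t x ∂D}

lemma bad_finite {m : ℕ} (hm : 0 < m) (A : Matrix (Fin n) (Fin N) ℝ) (τ lam : ℝ) (hτ : 0 < τ)
    (hlam : 0 < lam) (L : ℕ) (hL : 2 ≤ L) (Bin Bout : ℝ) (hBin : 0 < Bin) (hBout : 0 < Bout)
    (D : Measure (Fin N → ℝ)) [IsProbabilityMeasure D]
    (δ : ℝ) (hδ : 0 < δ) (hδ1 : δ < 1) (F : Finset (Par N)) (hF : F.Nonempty) :
    (Measure.pi fun _ : Fin m => D) (⋃ t ∈ F, bad A τ lam L Bin Bout δ D t) ≤ ENNReal.ofReal δ := by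
  refine le_trans (measure_mono ?_) (stat_bound D F hF (tl A τ lam L Bout Bin)
    (tl_measurable A τ lam hτ hlam L Bout Bin hBout) (Bin + Bout) (tl_nonneg A τ lam L Bout Bin)
    (tl_le A τ lam L Bout Bin hBout hBin) (by positivity) hm δ hδ hδ1)
  intro X hX
  simp only [Set.mem_iUnion, exists_prop] at hX
  obtain ⟨t, ht, hX⟩ := hX
  refine ⟨t, ht, ?_⟩
  have h := rhs_bound hm A τ lam hτ hlam L hL Bout Bin hBout hBin δ hδ hδ1 X F hF
  have hX' : (1 / (m : ℝ)) * ∑ i, tl A τ lam L Bout Bin t (X i) + rhs A τ L Bin Bout δ X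
    ≤ ∫ x, tl A τ lam L Bout Bin t x ∂D := hX
  linarith

lemma bad_countable {m : ℕ} (hm : 0 < m) (A : Matrix (Fin n) (Fin N) ℝ) (τ lam : ℝ) (hτ : 0 < τ)
    (hlam : 0 < lam) (L : ℕ) (hL : 2 ≤ L) (Bin Bout : ℝ) (hBin : 0 < Bin) (hBout : 0 < Bout)
    (D : Measure (Fin N → ℝ)) [IsProbabilityMeasure D]
    (δ : ℝ) (hδ : 0 < δ) (hδ1 : δ < 1) (u : ℕ → Par N) :
    (Measure.pi fun _ : Fin m => D) (⋃ k, bad A τ lam L Bin Bout δ D (u k)) ≤ ENNReal.ofReal δ := by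
  classical
  let F : ℕ → Finset (Par N) := fun k => (Finset.range (k + 1)).image u
  have hmono : Monotone fun k => ⋃ t ∈ F k, bad (m := m) A τ lam L Bin Bout δ D t := by
    intro a b hab
    refine Set.biUnion_subset_biUnion_left ?_
    intro t ht
    simp only [F, Finset.coe_image, Set.mem_image, Finset.coe_range, Set.mem_Iio] at ht ⊢
    obtain ⟨x, hx, rfl⟩ := ht
    exact ⟨x, by omega, rfl⟩
  have hsub : (⋃ k, bad (m := m) A τ lam L Bin Bout δ D (u k)) ⊆
      ⋃ k, ⋃ t ∈ F k, bad A τ lam L Bin Bout δ D t := by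
    refine Set.iUnion_mono fun k => ?_
    refine Set.subset_biUnion_of_mem (u := fun t => bad A τ lam L Bin Bout δ D t) ?_
    exact Finset.mem_image_of_mem u (by simp)
  refine (measure_mono hsub).trans ?_
  rw [hmono.measure_iUnion]
  refine iSup_le fun k => ?_
  exact bad_finite hm A τ lam hτ hlam L hL Bin Bout hBin hBout D δ hδ hδ1 (F k)
    (Finset.Nonempty.image (by simp) u)

lemma continuous_hyp3 (A : Matrix (Fin n) (Fin N) ℝ) (τ lam : ℝ) (hτ : 0 < τ) (hlam : 0 < lam)
    (L : ℕ) (B : ℝ) (hB : 0 < B) (x : Fin N → ℝ) :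
    Continuous fun p : Matrix (Fin N) (Fin N) ℝ × Matrix (Fin N) (Fin N) ℝ =>
      l2 (hyp A τ lam L B p x - x) := by
  have h : Continuous fun p : Matrix (Fin N) (Fin N) ℝ × Matrix (Fin N) (Fin N) ℝ => (p, x) :=
    continuous_id.prodMk continuous_const
  have h2 := Continuous.comp (continuous_hyp2 A τ lam hτ hlam L B hB) h
  simp only [Function.comp_def] at h2
  exact h2

lemma continuous_risk (A : Matrix (Fin n) (Fin N) ℝ) (τ lam : ℝ) (hτ : 0 < τ)
    (hlam : 0 < lam) (L : ℕ) (Bin Bout : ℝ) (hBout : 0 < Bout)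
    (D : Measure (Fin N → ℝ)) [IsProbabilityMeasure D] (hbdd : ∀ᵐ x ∂D, l2 x ≤ Bin) :
    Continuous fun p : Matrix (Fin N) (Fin N) ℝ × Matrix (Fin N) (Fin N) ℝ =>
      ∫ x, l2 (hyp A τ lam L Bout p x - x) ∂D := by
  have hc := continuous_hyp2 A τ lam hτ hlam L Bout hBout
  refine continuous_of_dominated (bound := fun _ => Bin + Bout) ?_ ?_ (integrable_const _) ?_
  · intro p
    have h : Continuous fun x : Fin N → ℝ => (p, x) := by fun_prop
    exact (hc.comp h).measurable.aestronglyMeasurable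
  · intro p
    filter_upwards [hbdd] with x hx
    rw [Real.norm_eq_abs, abs_of_nonneg (l2_nonneg _)]
    have := l2_sub_le (hyp A τ lam L Bout p x) x
    have h2 : l2 (hyp A τ lam L Bout p x) ≤ Bout := l2_sigma Bout hBout _
    linarith
  · refine Filter.Eventually.of_forall fun x => ?_
    exact continuous_hyp3 A τ lam hτ hlam L Bout hBout x

lemma good_of {m : ℕ} (A : Matrix (Fin n) (Fin N) ℝ) (τ lam : ℝ) (hτ : 0 < τ)
    (hlam : 0 < lam) (L : ℕ) (Bin Bout : ℝ) (hBout : 0 < Bout)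
    (D : Measure (Fin N → ℝ)) [IsProbabilityMeasure D] (hbdd : ∀ᵐ x ∂D, l2 x ≤ Bin)
    (δ : ℝ) (u : ℕ → Par N) (hu : DenseRange u) (X : Fin m → Fin N → ℝ)
    (hX : ∀ i, l2 (X i) ≤ Bin) (hbad : ∀ k, X ∉ bad A τ lam L Bin Bout δ D (u k)) (t : Par N) :
    ∫ x, l2 (hyp A τ lam L Bout t.1 x - x) ∂D ≤
      (1 / (m : ℝ)) * ∑ i, l2 (hyp A τ lam L Bout t.1 (X i) - X i) + rhs A τ L Bin Bout δ X := by
  have hcl : IsClosed {t : Par N | ∫ x, l2 (hyp A τ lam L Bout t.1 x - x) ∂D ≤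
      (1 / (m : ℝ)) * ∑ i, l2 (hyp A τ lam L Bout t.1 (X i) - X i) + rhs A τ L Bin Bout δ X} := by
    refine isClosed_le ?_ ?_
    · exact (continuous_risk A τ lam hτ hlam L Bin Bout hBout D hbdd).comp continuous_subtype_val
    · refine Continuous.add (Continuous.mul continuous_const (continuous_finsetSum _ fun i _ => ?_))
        continuous_const
      exact (continuous_hyp3 A τ lam hτ hlam L Bout hBout (X i)).comp continuous_subtype_val
  have hden : ∀ k, u k ∈ {t : Par N | ∫ x, l2 (hyp A τ lam L Bout t.1 x - x) ∂D ≤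
      (1 / (m : ℝ)) * ∑ i, l2 (hyp A τ lam L Bout t.1 (X i) - X i) + rhs A τ L Bin Bout δ X} := by
    intro k
    have h := hbad k
    simp only [bad, Set.mem_setOf_eq, not_le] at h
    have e1 : ∫ x, tl A τ lam L Bout Bin (u k) x ∂D = ∫ x, l2 (hyp A τ lam L Bout (u k).1 x - x) ∂D := by
      refine integral_congr_ae ?_
      filter_upwards [hbdd] with x hx
      simp [tl, hx]
    have e2 : ∀ i, tl A τ lam L Bout Bin (u k) (X i) = l2 (hyp A τ lam L Bout (u k).1 (X i) - X i) := by
      intro i; simp [tl, hX i]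
    simp only [e2] at h
    rw [e1] at h
    exact h.le
  exact hcl.closure_subset_iff.2 (Set.range_subset_iff.2 hden) (hu t)

end final2
end ISTA

theorem statement16 {n N m : ℕ} (hm : 0 < m) (A : Matrix (Fin n) (Fin N) ℝ)
    (τ lam : ℝ) (hτ : 0 < τ) (hlam : 0 < lam) (L : ℕ) (hL : 2 ≤ L)
    (Bin Bout : ℝ) (hBin : 0 < Bin) (hBout : 0 < Bout)
    (D : Measure (Fin N → ℝ)) [IsProbabilityMeasure D]
    (hbdd : ∀ᵐ x ∂D, l2 x ≤ Bin)
    (δ : ℝ) (hδ : 0 < δ) (hδ1 : δ < 1) :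
    ENNReal.ofReal (1 - δ) ≤
      (Measure.pi fun _ : Fin m => D)
        {X : Fin m → Fin N → ℝ |
          ∀ Ψ Φ : Matrix (Fin N) (Fin N) ℝ, IsOrthogonal Ψ → IsOrthogonal Φ →
            (∫ x, l2 (sigma Bout (Ψ *ᵥ istaVec A τ lam Φ (A *ᵥ x) L) - x) ∂D) ≤
              (1 / (m : ℝ)) * ∑ i, l2 (sigma Bout (Ψ *ᵥ istaVec A τ lam Φ (A *ᵥ X i) L) - X i)
              + 8 * Bout * Real.sqrt ((N : ℝ) * (n : ℝ) / (m : ℝ)) *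
                  Real.sqrt (Real.log (Real.exp 1 * (1 +
                    8 * KL A τ (A * Matrix.of fun k i => X i k) L * specNorm A /
                      (Real.sqrt (m : ℝ) * Bout))))
              + 8 * Bout * ((N : ℝ) / Real.sqrt (m : ℝ)) *
                  Real.sqrt (Real.log (Real.exp 1 * (1 +
                    8 * ML A τ (A * Matrix.of fun k i => X i k) L /
                      (Real.sqrt (m : ℝ) * Bout))))
              + 4 * (Bin + Bout) * Real.sqrt (2 * Real.log (4 / δ) / (m : ℝ))} := by
  classical
  haveI : SecondCountableTopology (ISTA.Par N) :=
    Topology.IsEmbedding.subtypeVal.secondCountableTopology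
  obtain ⟨u, hu⟩ : ∃ u : ℕ → ISTA.Par N, DenseRange u := TopologicalSpace.exists_dense_seq _
  set P := Measure.pi fun _ : Fin m => D with hP
  set G := {X : Fin m → Fin N → ℝ |
          ∀ Ψ Φ : Matrix (Fin N) (Fin N) ℝ, IsOrthogonal Ψ → IsOrthogonal Φ →
            (∫ x, l2 (sigma Bout (Ψ *ᵥ istaVec A τ lam Φ (A *ᵥ x) L) - x) ∂D) ≤
              (1 / (m : ℝ)) * ∑ i, l2 (sigma Bout (Ψ *ᵥ istaVec A τ lam Φ (A *ᵥ X i) L) - X i)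
              + 8 * Bout * Real.sqrt ((N : ℝ) * (n : ℝ) / (m : ℝ)) *
                  Real.sqrt (Real.log (Real.exp 1 * (1 +
                    8 * KL A τ (A * Matrix.of fun k i => X i k) L * specNorm A /
                      (Real.sqrt (m : ℝ) * Bout))))
              + 8 * Bout * ((N : ℝ) / Real.sqrt (m : ℝ)) *
                  Real.sqrt (Real.log (Real.exp 1 * (1 +
                    8 * ML A τ (A * Matrix.of fun k i => X i k) L /
                      (Real.sqrt (m : ℝ) * Bout))))
              + 4 * (Bin + Bout) * Real.sqrt (2 * Real.log (4 / δ) / (m : ℝ))} with hG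
  set U : Set (Fin m → Fin N → ℝ) := ⋃ k, ISTA.bad A τ lam L Bin Bout δ D (u k) with hU
  have hUle : P U ≤ ENNReal.ofReal δ :=
    ISTA.bad_countable hm A τ lam hτ hlam L hL Bin Bout hBin hBout D δ hδ hδ1 u
  set Z : Set (Fin m → Fin N → ℝ) := {X | ¬ ∀ i, l2 (X i) ≤ Bin} with hZ
  have hZ0 : P Z = 0 := by
    have : ∀ᵐ X ∂P, ∀ i, l2 (X i) ≤ Bin := by
      rw [ae_all_iff]
      intro i
      exact (Measure.quasiMeasurePreserving_eval (fun _ : Fin m => D) i).ae hbdd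
    exact this
  have hsub : Gᶜ ⊆ U ∪ Z := by
    rw [Set.compl_subset_comm]
    intro X hX
    simp only [Set.mem_compl_iff, Set.mem_union, not_or] at hX
    obtain ⟨h1, h2⟩ := hX
    have h2' : ∀ i, l2 (X i) ≤ Bin := by simpa [hZ] using h2
    have h1' : ∀ k, X ∉ ISTA.bad A τ lam L Bin Bout δ D (u k) := by simpa [hU] using h1
    intro Ψ Φ hΨ hΦ
    have := ISTA.good_of A τ lam hτ hlam L Bin Bout hBout D hbdd δ u hu X h2' h1' ⟨(Ψ, Φ), hΨ, hΦ⟩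
    simp only [ISTA.hyp, ISTA.rhs] at this
    linarith
  have hGc : P Gᶜ ≤ ENNReal.ofReal δ := by
    calc P Gᶜ ≤ P (U ∪ Z) := measure_mono hsub
      _ ≤ P U + P Z := measure_union_le _ _
      _ ≤ _ := by rw [hZ0, add_zero]; exact hUle
  have hone : (1 : ℝ≥0∞) ≤ P G + P Gᶜ := by
    calc (1 : ℝ≥0∞) = P Set.univ := by rw [measure_univ]
      _ = P (G ∪ Gᶜ) := by rw [Set.union_compl_self]
      _ ≤ _ := measure_union_le _ _
  rw [ENNReal.ofReal_sub _ hδ.le, ENNReal.ofReal_one, tsub_le_iff_right]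
  exact hone.trans (by gcongr)
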